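/- arXiv:1501.01328 — 5 statements merged into one kernel-verified Lean document; each statement's English description precedes it below -/
import Mathlib

section
/- Let Ω be a functorially finite resolving subcategory of A-mod, let 0 → N →f M →g Z → 0 be a short exact sequence of finitely generated A-modules with Z an indecomposable module belonging to Ω, and let f_M : X_M → M be a right Ω-approximation of M. Then the composition g∘f_M is surjective; writing X_N for its kernel and i : X_N → X_M for the inclusion, the morphism f_N : X_N → N induced by f_M∘i (whose image lies in Ker(g) ≅ N) is a right Ω-approximation of N, so that there is a commutative diagram with exact rows 0 → X_N →i X_M →(g∘f_M) Z → 0 over 0 → N →f M →g Z → 0 (with identity on Z); moreover the top row splits if and only if the bottom row splits. -/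
open CategoryTheory Limits

universe u

section Base
variable {A : Type} [Ring A]

/-- An object of `ModuleCat A` is indecomposable. -/
def Indec (X : ModuleCat.{0} A) : Prop :=
  Nontrivial X ∧ ∀ e : X ⟶ X, e ≫ e = e → e = 0 ∨ e = 𝟙 X

/-- `f` is irreducible with respect to the subcategory `χ`. -/
def IrredIn (χ : ModuleCat.{0} A → Prop) {X Y : ModuleCat.{0} A} (f : X ⟶ Y) : Prop :=
  ¬ IsSplitMono f ∧ ¬ IsSplitEpi f ∧
    ∀ (Z : ModuleCat.{0} A), χ Z → ∀ (h : X ⟶ Z) (g : Z ⟶ Y), f = h ≫ g →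
      IsSplitMono h ∨ IsSplitEpi g

def RightAlmostSplitIn (χ : ModuleCat.{0} A → Prop) {X Y : ModuleCat.{0} A} (f : X ⟶ Y) : Prop :=
  ¬ IsSplitEpi f ∧ ∀ (Z : ModuleCat.{0} A), χ Z → ∀ g : Z ⟶ Y, ¬ IsSplitEpi g →
    ∃ h : Z ⟶ X, h ≫ f = g

def LeftAlmostSplitIn (χ : ModuleCat.{0} A → Prop) {X Y : ModuleCat.{0} A} (f : X ⟶ Y) : Prop :=
  ¬ IsSplitMono f ∧ ∀ (Z : ModuleCat.{0} A), χ Z → ∀ g : X ⟶ Z, ¬ IsSplitMono g →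
    ∃ h : Y ⟶ Z, f ≫ h = g

def RightMinimal {X Y : ModuleCat.{0} A} (f : X ⟶ Y) : Prop :=
  ∀ h : X ⟶ X, h ≫ f = f → IsIso h

def LeftMinimal {X Y : ModuleCat.{0} A} (f : X ⟶ Y) : Prop :=
  ∀ h : Y ⟶ Y, f ≫ h = f → IsIso h

def MinimalRightAlmostSplitIn (χ : ModuleCat.{0} A → Prop) {X Y : ModuleCat.{0} A}
    (f : X ⟶ Y) : Prop :=
  RightMinimal f ∧ RightAlmostSplitIn χ f

def MinimalLeftAlmostSplitIn (χ : ModuleCat.{0} A → Prop) {X Y : ModuleCat.{0} A}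
    (f : X ⟶ Y) : Prop :=
  LeftMinimal f ∧ LeftAlmostSplitIn χ f

/-- `0 → X → Y → Z → 0` is a short exact sequence. -/
def IsSES {X Y Z : ModuleCat.{0} A} (f : X ⟶ Y) (g : Y ⟶ Z) : Prop :=
  Function.Injective f ∧ Function.Surjective g ∧ Function.Exact f g

/-- `0 → X → Y → Z → 0` is an almost split sequence in `χ`. -/
def IsAlmostSplitSeq (χ : ModuleCat.{0} A → Prop) {X Y Z : ModuleCat.{0} A}
    (f : X ⟶ Y) (g : Y ⟶ Z) : Prop :=
  IsSES f g ∧ MinimalLeftAlmostSplitIn χ f ∧ MinimalRightAlmostSplitIn χ g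

/-- `f : X → Y` is a right `χ`-approximation of `Y`. -/
def RightApprox (χ : ModuleCat.{0} A → Prop) {X Y : ModuleCat.{0} A} (f : X ⟶ Y) : Prop :=
  χ X ∧ ∀ (Z : ModuleCat.{0} A), χ Z → ∀ g : Z ⟶ Y, ∃ h : Z ⟶ X, h ≫ f = g

def LeftApprox (χ : ModuleCat.{0} A → Prop) {X Y : ModuleCat.{0} A} (f : X ⟶ Y) : Prop :=
  χ Y ∧ ∀ (Z : ModuleCat.{0} A), χ Z → ∀ g : X ⟶ Z, ∃ h : Y ⟶ Z, f ≫ h = g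

def MinimalRightApprox (χ : ModuleCat.{0} A → Prop) {X Y : ModuleCat.{0} A} (f : X ⟶ Y) : Prop :=
  RightApprox χ f ∧ RightMinimal f

def ContravariantlyFinite (χ : ModuleCat.{0} A → Prop) : Prop :=
  ∀ Y : ModuleCat.{0} A, Module.Finite A Y → ∃ (X : ModuleCat.{0} A) (f : X ⟶ Y), RightApprox χ f

def CovariantlyFinite (χ : ModuleCat.{0} A → Prop) : Prop :=
  ∀ X : ModuleCat.{0} A, Module.Finite A X → ∃ (Y : ModuleCat.{0} A) (f : X ⟶ Y), LeftApprox χ f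

def FunctoriallyFinite (χ : ModuleCat.{0} A → Prop) : Prop :=
  ContravariantlyFinite χ ∧ CovariantlyFinite χ

/-- `χ` is a subcategory of `A`-mod: its objects are finitely generated, and it is
closed under isomorphisms, finite direct sums and direct summands. -/
def IsSubcat (χ : ModuleCat.{0} A → Prop) : Prop :=
  (∀ X : ModuleCat.{0} A, χ X → Module.Finite A X) ∧
  (∀ X Y : ModuleCat.{0} A, (X ≅ Y) → χ X → χ Y) ∧
  (∀ X Y : ModuleCat.{0} A, χ X → χ Y → χ (X ⊞ Y)) ∧
  (∀ X Y Z : ModuleCat.{0} A, (X ≅ Y ⊞ Z) → χ X → χ Y)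

def ClosedUnderExtensions (χ : ModuleCat.{0} A → Prop) : Prop :=
  ∀ (X Y Z : ModuleCat.{0} A) (f : X ⟶ Y) (g : Y ⟶ Z), IsSES f g → χ X → χ Z → χ Y

def ContainsProjectives (χ : ModuleCat.{0} A → Prop) : Prop :=
  ∀ P : ModuleCat.{0} A, Module.Finite A P → Projective P → χ P

/-- `Ω` is a resolving subcategory: closed under extensions, contains `A`, and is closed
under kernels of epimorphisms. -/
def Resolving (Ω : ModuleCat.{0} A → Prop) : Prop :=
  ClosedUnderExtensions Ω ∧ Ω (ModuleCat.of A A) ∧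
  (∀ (X Y K : ModuleCat.{0} A) (f : X ⟶ Y) (i : K ⟶ X), Ω X → Ω Y →
    Function.Surjective f → Function.Injective i → Function.Exact i f → Ω K)

/-- `n` is the Jordan–Hölder length of the module `X`. -/
def IsJHLength (X : ModuleCat.{0} A) (n : ℕ) : Prop :=
  ∃ s : CompositionSeries (Submodule A X), s.head = ⊥ ∧ s.last = ⊤ ∧ s.length = n

end Base

section Lifting
variable {A : Type} [Ring A]

/-- An injective map that is exact at its target is a kernel: morphisms killed by `g`
factor through it. -/
theorem exists_lift_of_exact {W X Y Z : ModuleCat.{0} A} {f : X ⟶ Y} {g : Y ⟶ Z}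
    (hf : Function.Injective f) (hfg : Function.Exact f g) (h : W ⟶ Y) (hh : h ≫ g = 0) :
    ∃ k : W ⟶ X, k ≫ f = h := by
  have hmem : ∀ w, h.hom w ∈ LinearMap.range f.hom := fun w =>
    (hfg (h w)).1 (by simpa using ConcreteCategory.congr_hom hh w)
  refine ⟨ModuleCat.ofHom ((LinearEquiv.ofInjective f.hom hf).symm.toLinearMap ∘ₗ
    h.hom.codRestrict _ hmem), ?_⟩
  ext w
  exact congrArg Subtype.val
    ((LinearEquiv.ofInjective f.hom hf).apply_symm_apply (h.hom.codRestrict _ hmem w))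

/-- A right `χ`-approximation is surjective as soon as `χ` contains `A`. -/
theorem RightApprox.surjective {χ : ModuleCat.{0} A → Prop} (hA : χ (ModuleCat.of A A))
    {X Y : ModuleCat.{0} A} {f : X ⟶ Y} (hf : RightApprox χ f) : Function.Surjective f := by
  intro y
  obtain ⟨h, hh⟩ := hf.2 _ hA (ModuleCat.ofHom (LinearMap.toSpanSingleton A Y y))
  exact ⟨h (1 : A), by simpa using ConcreteCategory.congr_hom hh (1 : A)⟩

theorem comp_eq_zero_of_exact {X Y Z : ModuleCat.{0} A} {f : X ⟶ Y} {g : Y ⟶ Z}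
    (hfg : Function.Exact f g) : f ≫ g = 0 := by
  ext x
  exact hfg.apply_apply_eq_zero x

end Lifting

/-!
Statement 0: pulling back a right `Ω`-approximation along a short exact sequence
`0 → N → M → Z → 0` with `Z` indecomposable in `Ω` yields a right `Ω`-approximation
of `N`, a commutative diagram with exact rows, and the top row splits iff the bottom
row splits.
-/

theorem stmt_0 {K : Type} [Field K] [IsAlgClosed K]
    {A : Type} [Ring A] [Algebra K A] [FiniteDimensional K A]
    (Ω : ModuleCat.{0} A → Prop)
    (hsub : IsSubcat Ω) (hff : FunctoriallyFinite Ω) (hres : Resolving Ω)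
    (N M Z : ModuleCat.{0} A)
    (hN : Module.Finite A N) (hM : Module.Finite A M) (hZ : Module.Finite A Z)
    (f : N ⟶ M) (g : M ⟶ Z) (hses : IsSES f g)
    (hZind : Indec Z) (hZΩ : Ω Z)
    (XM : ModuleCat.{0} A) (fM : XM ⟶ M) (hfM : RightApprox Ω fM) :
    -- the composition `g ∘ f_M` is surjective
    Function.Surjective (fM ≫ g) ∧
    -- for any kernel presentation `i : X_N → X_M` of `g ∘ f_M`:
    ∀ (XN : ModuleCat.{0} A) (i : XN ⟶ XM),
      Function.Injective i → Function.Exact i (fM ≫ g) →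
      ∃ fN : XN ⟶ N,
        -- the diagram commutes (the square over `Z` being the identity square)
        i ≫ fM = fN ≫ f ∧
        -- the induced morphism is a right `Ω`-approximation of `N`
        RightApprox Ω fN ∧
        -- the top row splits iff the bottom row splits
        ((∃ s : Z ⟶ XM, s ≫ (fM ≫ g) = 𝟙 Z) ↔ (∃ s : Z ⟶ M, s ≫ g = 𝟙 Z)) := by
  obtain ⟨hf, hg, hfg⟩ := hses
  have hsurj : Function.Surjective (fM ≫ g) := by
    simpa using hg.comp (hfM.surjective hres.2.1)
  refine ⟨hsurj, fun XN i hi hex => ?_⟩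
  have hi0 : (i ≫ fM) ≫ g = 0 := by
    rw [Category.assoc, comp_eq_zero_of_exact hex]
  obtain ⟨fN, hfN⟩ := exists_lift_of_exact hf hfg (i ≫ fM) hi0
  refine ⟨fN, hfN.symm, ⟨hres.2.2 XM Z XN (fM ≫ g) i hfM.1 hZΩ hsurj hi hex,
    fun W hW t => ?_⟩, fun ⟨s, hs⟩ => ⟨s ≫ fM, by simpa using hs⟩, fun ⟨s, hs⟩ => ?_⟩
  · obtain ⟨u, hu⟩ := hfM.2 W hW (t ≫ f)
    have hu0 : u ≫ fM ≫ g = 0 := by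
      rw [← Category.assoc, hu, Category.assoc, comp_eq_zero_of_exact hfg, comp_zero]
    obtain ⟨k, hk⟩ := exists_lift_of_exact hi hex u hu0
    have : Mono f := (ModuleCat.mono_iff_injective f).2 hf
    refine ⟨k, (cancel_mono f).1 ?_⟩
    rw [Category.assoc, hfN, ← Category.assoc, hk, hu]
  · obtain ⟨h, hh⟩ := hfM.2 Z hZΩ s
    exact ⟨h, by rw [← Category.assoc, hh, hs]⟩
end

section
/- Let Ω be a functorially finite resolving subcategory of A-mod. If M is a finitely generated A-module and X_M denotes the domain of a minimal right Ω-approximation of M, then l(X_M) ≤ l(M)·s, where s = max{ l(X_S) : S a simple A-module } and X_S denotes the domain of a minimal right Ω-approximation of S. -/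
open CategoryTheory Limits

universe u

/-- Pushout of a short exact sequence `K → P → Z` along a map `k : K → X`. -/
lemma exists_pushout_extension {A : Type} [Ring A] {X K P Z : Type}
    [AddCommGroup X] [Module A X] [AddCommGroup K] [Module A K]
    [AddCommGroup P] [Module A P] [AddCommGroup Z] [Module A Z]
    (k : K →ₗ[A] X) (i : K →ₗ[A] P) (p : P →ₗ[A] Z) (hi : Function.Injective i)
    (hp : Function.Surjective p) (hip : Function.Exact i p) :
    ∃ (E : Type) (_ : AddCommGroup E) (_ : Module A E) (j : X →ₗ[A] E) (l : P →ₗ[A] E)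
      (c : E →ₗ[A] Z), Function.Injective j ∧ Function.Surjective c ∧ Function.Exact j c ∧
      j ∘ₗ k = l ∘ₗ i ∧ c ∘ₗ l = p ∧
      ∀ (M : Type) [AddCommGroup M] [Module A M] (f : X →ₗ[A] M) (g : P →ₗ[A] M),
        f ∘ₗ k = g ∘ₗ i → ∃ φ : E →ₗ[A] M, φ ∘ₗ j = f ∧ φ ∘ₗ l = g := by
  set R : Submodule A (X × P) := LinearMap.range (k.prod (-i))
  have lift : ∀ (M : Type) [AddCommGroup M] [Module A M] (f : X →ₗ[A] M) (g : P →ₗ[A] M),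
      f ∘ₗ k = g ∘ₗ i → R ≤ LinearMap.ker (f.coprod g) := by
    rintro M _ _ f g h _ ⟨x, rfl⟩
    simpa [← sub_eq_add_neg, sub_eq_zero] using LinearMap.congr_fun h x
  have hc := lift Z 0 p (by ext x; simpa using (hip.apply_apply_eq_zero x).symm)
  refine ⟨(X × P) ⧸ R, inferInstance, inferInstance, R.mkQ ∘ₗ LinearMap.inl A X P,
    R.mkQ ∘ₗ LinearMap.inr A X P, R.liftQ _ hc, ?_, ?_, ?_, ?_, ?_, ?_⟩
  · rw [injective_iff_map_eq_zero]
    intro x hx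
    obtain ⟨y, hy⟩ : (x, (0 : P)) ∈ R := by simpa [Submodule.Quotient.mk_eq_zero] using hx
    simp only [LinearMap.prod_apply, Function.prod_apply, Prod.mk.injEq, LinearMap.neg_apply,
      neg_eq_zero] at hy
    rw [← hy.1, hi (hy.2.trans (map_zero i).symm), map_zero]
  · intro z
    obtain ⟨y, rfl⟩ := hp z
    exact ⟨R.mkQ (0, y), by simp⟩
  · intro e
    obtain ⟨⟨x, y⟩, rfl⟩ := R.mkQ_surjective e
    constructor
    · intro h
      obtain ⟨w, rfl⟩ := (hip y).1 (by simpa using h)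
      refine ⟨x + k w, ?_⟩
      simp only [LinearMap.comp_apply, Submodule.mkQ_apply]
      rw [Submodule.Quotient.eq]
      exact ⟨w, by simp⟩
    · rintro ⟨x', h⟩
      rw [← h]
      simp
  · ext w
    simp only [LinearMap.comp_apply, Submodule.mkQ_apply]
    rw [Submodule.Quotient.eq]
    exact ⟨w, by simp⟩
  · ext y
    simp
  · intro M _ _ f g h
    exact ⟨R.liftQ _ (lift M f g h), by ext; simp, by ext; simp⟩

/-- Every extension of a module in `Ω` by `Y` splits. -/
def ExtOrthogonal {A : Type} [Ring A] (Ω : ModuleCat.{0} A → Prop) (Y : Type) [AddCommGroup Y]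
    [Module A Y] : Prop :=
  ∀ (D Z : Type) [AddCommGroup D] [Module A D] [AddCommGroup Z] [Module A Z]
    (i : Y →ₗ[A] D) (p : D →ₗ[A] Z), Ω (ModuleCat.of A Z) → Function.Injective i →
    Function.Surjective p → Function.Exact i p → ∃ σ : Z →ₗ[A] D, p ∘ₗ σ = LinearMap.id

section
variable {A : Type} [Ring A] {Ω : ModuleCat.{0} A → Prop}

lemma ExtOrthogonal.of_subsingleton {Y : Type} [AddCommGroup Y] [Module A Y] [Subsingleton Y] :
    ExtOrthogonal Ω Y := by
  intro D Z _ _ _ _ i p _ _ hp hip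
  have hinj : Function.Injective p := by
    rw [injective_iff_map_eq_zero]
    intro d hd
    obtain ⟨y, rfl⟩ := (hip d).1 hd
    rw [Subsingleton.elim y 0, map_zero]
  exact ⟨(LinearEquiv.ofBijective p ⟨hinj, hp⟩).symm,
    LinearMap.ext fun z => LinearEquiv.apply_symm_apply (LinearEquiv.ofBijective p ⟨hinj, hp⟩) z⟩

/-- `ExtOrthogonal Ω` is closed under extensions. -/
lemma ExtOrthogonal.of_exact {Y' Y Y'' : Type} [AddCommGroup Y'] [Module A Y']
    [AddCommGroup Y] [Module A Y] [AddCommGroup Y''] [Module A Y'']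
    (a : Y' →ₗ[A] Y) (b : Y →ₗ[A] Y'') (ha : Function.Injective a) (hb : Function.Surjective b)
    (hab : Function.Exact a b) (h' : ExtOrthogonal Ω Y') (h'' : ExtOrthogonal Ω Y'') :
    ExtOrthogonal Ω Y := by
  intro D Z _ _ _ _ i p hZ hi hp hip
  obtain ⟨E, _, _, j, l, c, hj, hc, hjc, hjl, hcl, -⟩ := exists_pushout_extension b i p hi hp hip
  obtain ⟨τ, hτ⟩ := h'' E Z j c hZ hj hc hjc
  have hl0 : ∀ d, l d = 0 → ∃ y', i (a y') = d := by
    intro d hd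
    obtain ⟨y, rfl⟩ := (hip d).1 (by rw [← hcl, LinearMap.comp_apply, hd, map_zero])
    have : j (b y) = 0 := (LinearMap.congr_fun hjl y).trans hd
    obtain ⟨y', rfl⟩ := (hab y).1 (hj (this.trans (map_zero j).symm))
    exact ⟨y', rfl⟩
  have hlsurj : Function.Surjective l := by
    intro e
    obtain ⟨d, hd⟩ := hp (c e)
    obtain ⟨y'', hy⟩ := (hjc (e - l d)).1 (by
      rw [map_sub, ← hd, ← LinearMap.comp_apply, hcl, sub_self])
    obtain ⟨y, rfl⟩ := hb y''
    refine ⟨i y + d, ?_⟩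
    have := LinearMap.congr_fun hjl y
    simp only [LinearMap.comp_apply] at this
    rw [map_add, ← this, hy, sub_add_cancel]
  have hτz : ∀ z, c (τ z) = z := LinearMap.congr_fun hτ
  have hpd : ∀ d, c (l d) = p d := LinearMap.congr_fun hcl
  let D' : Submodule A D := (LinearMap.range τ).comap l
  have hD' : ∀ d ∈ D', l d = τ (p d) := by
    rintro d ⟨z, hz⟩
    rw [← hpd, ← hz, hτz]
  have hla : ∀ y', l (i (a y')) = 0 := by
    intro y'
    have := LinearMap.congr_fun hjl (a y')
    simp only [LinearMap.comp_apply] at this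
    rw [← this, hab.apply_apply_eq_zero, map_zero]
  let i' : Y' →ₗ[A] D' := (i ∘ₗ a).codRestrict D' fun y' => ⟨0, by
    rw [map_zero]; exact (hla y').symm⟩
  obtain ⟨σ, hσ⟩ := h' D' Z i' (p ∘ₗ D'.subtype) hZ
    (fun x y hxy => ha (hi (congrArg Subtype.val hxy)))
    (by
      intro z
      obtain ⟨d, hd⟩ := hlsurj (τ z)
      exact ⟨⟨d, z, hd.symm⟩, by simp [← hpd, hd, hτz]⟩)
    (by
      rintro ⟨d, hd⟩
      constructor
      · intro h
        obtain ⟨y', hy'⟩ := hl0 d (by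
          rw [hD' d hd]
          exact (congrArg τ h).trans (map_zero τ))
        exact ⟨y', Subtype.ext hy'⟩
      · rintro ⟨y', hy'⟩
        rw [← hy']
        exact hip.apply_apply_eq_zero (a y'))
  exact ⟨D'.subtype ∘ₗ σ, hσ⟩

/-- A surjection with `ExtOrthogonal` kernel lifts all maps from modules in `Ω`. -/
lemma ExtOrthogonal.exists_lift {X M Z : Type} [AddCommGroup X] [Module A X] [AddCommGroup M]
    [Module A M] [AddCommGroup Z] [Module A Z] (f : X →ₗ[A] M) (hf : Function.Surjective f)
    (h : ExtOrthogonal Ω (LinearMap.ker f)) (hZ : Ω (ModuleCat.of A Z)) (g : Z →ₗ[A] M) :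
    ∃ g' : Z →ₗ[A] X, f ∘ₗ g' = g := by
  let D : Submodule A (X × Z) := LinearMap.ker (f.coprod (-g))
  have hD : ∀ d : D, f d.1.1 = g d.1.2 := by
    rintro ⟨⟨x, z⟩, hd⟩
    simpa [D, add_neg_eq_zero] using hd
  obtain ⟨σ, hσ⟩ := h D Z
    ((LinearMap.inl A X Z ∘ₗ (LinearMap.ker f).subtype).codRestrict D (by
      rintro ⟨x, hx⟩
      simpa [D] using hx))
    (LinearMap.snd A X Z ∘ₗ D.subtype) hZ
    (fun x y hxy => Subtype.ext (congrArg (fun d : D => d.1.1) hxy))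
    (by
      intro z
      obtain ⟨x, hx⟩ := hf (g z)
      exact ⟨⟨(x, z), by simp [D, hx]⟩, rfl⟩)
    (by
      rintro ⟨⟨x, z⟩, hd⟩
      constructor
      · intro hz
        have hz : z = 0 := hz
        subst hz
        exact ⟨⟨x, by simpa using hD ⟨(x, 0), hd⟩⟩, rfl⟩
      · rintro ⟨y, hy⟩
        rw [← hy]
        rfl)
  refine ⟨LinearMap.fst A X Z ∘ₗ D.subtype ∘ₗ σ, ?_⟩
  ext z
  exact (hD (σ z)).trans (congrArg g (LinearMap.congr_fun hσ z))

/-- Wakamatsu's lemma. -/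
lemma MinimalRightApprox.extOrthogonal_ker (hext : ClosedUnderExtensions Ω)
    {X M : ModuleCat.{0} A} {f : X ⟶ M} (hf : MinimalRightApprox Ω f) :
    ExtOrthogonal Ω (LinearMap.ker f.hom) := by
  intro D Z _ _ _ _ i p hZ hi hp hip
  obtain ⟨E, _, _, j, l, c, hj, hc, hjc, hjl, hcl, hdesc⟩ :=
    exists_pushout_extension (LinearMap.ker f.hom).subtype i p hi hp hip
  obtain ⟨φ, hφj, hφl⟩ := hdesc M f.hom 0 (by ext y; simp)
  have hE : Ω (ModuleCat.of A E) :=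
    hext X (ModuleCat.of A E) (ModuleCat.of A Z) (ModuleCat.ofHom j) (ModuleCat.ofHom c)
      ⟨hj, hc, hjc⟩ hf.1.1 hZ
  obtain ⟨r, hr⟩ := hf.1.2 _ hE (ModuleCat.ofHom φ)
  have hθf : (ModuleCat.ofHom j ≫ r) ≫ f = f := by
    rw [Category.assoc, hr]
    ext x
    exact LinearMap.congr_fun hφj x
  have := hf.2 _ hθf
  let ρ : E →ₗ[A] X := (r ≫ inv (ModuleCat.ofHom j ≫ r)).hom
  have hρj : ∀ x, ρ (j x) = x := fun x =>
    congrArg (fun h : X ⟶ X => h.hom x) (IsIso.hom_inv_id (ModuleCat.ofHom j ≫ r))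
  have hρf : ∀ e, f.hom (ρ e) = φ e := by
    intro e
    have h1 : (r ≫ inv (ModuleCat.ofHom j ≫ r)) ≫ f = ModuleCat.ofHom φ := by
      rw [Category.assoc, (IsIso.inv_comp_eq _).2 hθf.symm, hr]
    exact congrArg (fun h : ModuleCat.of A E ⟶ M => h.hom e) h1
  have hli : ∀ y, l (i y) = j y.1 := fun y => (LinearMap.congr_fun hjl y).symm
  let t : D →ₗ[A] LinearMap.ker f.hom := (ρ ∘ₗ l).codRestrict _ fun d => by
    simpa [hρf] using LinearMap.congr_fun hφl d
  have ht : t ∘ₗ i = LinearMap.id := by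
    ext y
    simp [t, hli, hρj]
  obtain ⟨-, hsplit⟩ : Function.Injective i ∧ ∃ σ, p ∘ₗ σ = LinearMap.id :=
    (hip.split_tfae'.out 1 0 :).1 ⟨hp, t, ht⟩
  exact hsplit

/-- The horseshoe construction for approximations. -/
lemma exists_horseshoe {M X' XS P : Type} [AddCommGroup M] [Module A M] [AddCommGroup X']
    [Module A X'] [AddCommGroup XS] [Module A XS] [AddCommGroup P] [Module A P]
    [Module.Projective A P] (N : Submodule A M)
    (f' : X' →ₗ[A] N) (hf' : Function.Surjective f') (h' : ExtOrthogonal Ω (LinearMap.ker f'))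
    (g : XS →ₗ[A] M ⧸ N) (hg : Function.Surjective g) (hS : ExtOrthogonal Ω (LinearMap.ker g))
    (p : P →ₗ[A] XS) (hp : Function.Surjective p) (hK : Ω (ModuleCat.of A (LinearMap.ker p))) :
    ∃ (X : Type) (_ : AddCommGroup X) (_ : Module A X) (j : X' →ₗ[A] X) (c : X →ₗ[A] XS)
      (f : X →ₗ[A] M), Function.Injective j ∧ Function.Surjective c ∧ Function.Exact j c ∧
      Function.Surjective f ∧ ExtOrthogonal Ω (LinearMap.ker f) := by
  obtain ⟨q, hq⟩ := Module.projective_lifting_property N.mkQ (g ∘ₗ p) N.mkQ_surjective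
  have hqp : ∀ y, N.mkQ (q y) = g (p y) := LinearMap.congr_fun hq
  have hqN : ∀ y, g (p y) = 0 → q y ∈ N := by
    intro y hy
    rw [← hqp] at hy
    simpa using hy
  obtain ⟨k, hk⟩ := h'.exists_lift f' hf' hK
    ((q ∘ₗ (LinearMap.ker p).subtype).codRestrict N fun y => hqN _ (by
      rw [Submodule.subtype_apply, LinearMap.mem_ker.1 y.2, map_zero]))
  obtain ⟨X, _, _, j, l, c, hj, hc, hjc, hjl, hcl, hdesc⟩ :=
    exists_pushout_extension k (LinearMap.ker p).subtype p (LinearMap.ker p).injective_subtype hp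
      (LinearMap.exact_subtype_ker_map p)
  obtain ⟨f, hfj, hfl⟩ := hdesc M (N.subtype ∘ₗ f') q (by
    rw [LinearMap.comp_assoc, hk]
    rfl)
  have hfj' : ∀ x, f (j x) = f' x := LinearMap.congr_fun hfj
  have hfl' : ∀ y, f (l y) = q y := LinearMap.congr_fun hfl
  have hcl' : ∀ y, c (l y) = p y := LinearMap.congr_fun hcl
  have hdecomp : ∀ x, ∃ x' y, x = j x' + l y := by
    intro x
    obtain ⟨y, hy⟩ := hp (c x)
    obtain ⟨x', hx'⟩ := (hjc (x - l y)).1 (by rw [map_sub, hcl', hy, sub_self])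
    exact ⟨x', y, by rw [hx', sub_add_cancel]⟩
  have hgc : ∀ x, g (c x) = N.mkQ (f x) := by
    intro x
    obtain ⟨x', y, rfl⟩ := hdecomp x
    simp [hjc.apply_apply_eq_zero, hcl', hfj', hfl', ← hqp]
  refine ⟨X, _, _, j, c, f, hj, hc, hjc, ?_, ?_⟩
  · intro m
    obtain ⟨t, ht⟩ := hg (N.mkQ m)
    obtain ⟨x, rfl⟩ := hc t
    rw [hgc, ← sub_eq_zero, ← map_sub, Submodule.mkQ_apply, Submodule.Quotient.mk_eq_zero] at ht
    obtain ⟨x', hx'⟩ := hf' ⟨f x - m, ht⟩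
    exact ⟨x - j x', by rw [map_sub, hfj', hx', sub_sub_cancel]⟩
  · refine ExtOrthogonal.of_exact
      ((j ∘ₗ (LinearMap.ker f').subtype).codRestrict (LinearMap.ker f) fun y => by simp [hfj'])
      ((c ∘ₗ (LinearMap.ker f).subtype).codRestrict (LinearMap.ker g) fun y => by simp [hgc])
      (fun x y hxy => Subtype.ext (hj (congrArg Subtype.val hxy))) ?_ ?_ h' hS
    · rintro ⟨t, ht⟩
      obtain ⟨x, rfl⟩ := hc t
      have hx : f x ∈ N := by
        rw [LinearMap.mem_ker, hgc] at ht
        simpa using ht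
      obtain ⟨x', hx'⟩ := hf' ⟨f x, hx⟩
      exact ⟨⟨x - j x', by simp [hfj', hx']⟩,
        Subtype.ext (by
          change c (x - j x') = c x
          rw [map_sub, hjc.apply_apply_eq_zero, sub_zero])⟩
    · rintro ⟨x, hx⟩
      constructor
      · intro h
        obtain ⟨x', rfl⟩ := (hjc x).1 (congrArg Subtype.val h)
        exact ⟨⟨x', by simpa [hfj'] using hx⟩, rfl⟩
      · rintro ⟨y, hy⟩
        rw [← hy]
        exact Subtype.ext (hjc.apply_apply_eq_zero _)

lemma Resolving.of_subsingleton (hres : Resolving Ω) (X : Type) [AddCommGroup X] [Module A X]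
    [Subsingleton X] : Ω (ModuleCat.of A X) :=
  hres.2.2 (ModuleCat.of A A) (ModuleCat.of A A) (ModuleCat.of A X) (𝟙 _) (ModuleCat.ofHom 0)
    hres.2.1 hres.2.1 Function.surjective_id (Function.injective_of_subsingleton _) (fun y =>
      ⟨fun h => ⟨0, h.symm⟩, by rintro ⟨x, rfl⟩; rfl⟩)

lemma Resolving.free (hres : Resolving Ω) (n : ℕ) : Ω (ModuleCat.of A (Fin n → A)) := by
  induction n with
  | zero => exact hres.of_subsingleton _
  | succ n ih =>
    refine hres.1 (ModuleCat.of A (Fin n → A)) _ (ModuleCat.of A A)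
      (ModuleCat.ofHom ((Fin.consLinearEquiv A fun _ => A).toLinearMap ∘ₗ
        LinearMap.inr A A (Fin n → A)))
      (ModuleCat.ofHom (LinearMap.proj 0)) ⟨?_, ?_, ?_⟩ ih hres.2.1
    · exact (Fin.consLinearEquiv A fun _ => A).injective.comp LinearMap.inr_injective
    · intro a
      exact ⟨fun _ => a, rfl⟩
    · intro v
      constructor
      · intro h
        refine ⟨Fin.tail v, ?_⟩
        have h : v 0 = 0 := h
        change Fin.cons 0 (Fin.tail v) = v
        rw [← h, Fin.cons_self_tail]
      · rintro ⟨w, rfl⟩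
        rfl

lemma RightApprox.surjective_s1 (hres : Resolving Ω) {X M : ModuleCat.{0} A} {f : X ⟶ M}
    (hf : RightApprox Ω f) : Function.Surjective f.hom := by
  intro m
  obtain ⟨h, hh⟩ := hf.2 _ hres.2.1 (ModuleCat.ofHom (LinearMap.toSpanSingleton A M m))
  refine ⟨h.hom (1 : A), ?_⟩
  have := congrArg (fun t : ModuleCat.of A A ⟶ M => t.hom (1 : A)) hh
  simpa using this

lemma IsSubcat.of_isCompl (hsub : IsSubcat Ω) {X : ModuleCat.{0} A} (hX : Ω X)
    {U V : Submodule A X} (h : IsCompl U V) : Ω (ModuleCat.of A U) :=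
  hsub.2.2.2 X (ModuleCat.of A U) (ModuleCat.of A V)
    ((Submodule.prodEquivOfIsCompl U V h).symm.toModuleIso ≪≫
      (ModuleCat.biprodIsoProd (ModuleCat.of A U) (ModuleCat.of A V)).symm) hX

lemma exists_minimalRightApprox [IsArtinianRing A] (hsub : IsSubcat Ω)
    (hcf : ContravariantlyFinite Ω) (Y : ModuleCat.{0} A) [Module.Finite A Y] :
    ∃ (X : ModuleCat.{0} A) (f : X ⟶ Y), MinimalRightApprox Ω f := by
  let T : Set ℕ∞ := {n | ∃ (X : ModuleCat.{0} A) (f : X ⟶ Y), RightApprox Ω f ∧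
    Module.length A X = n}
  have hT : T.Nonempty := by
    obtain ⟨X, f, hf⟩ := hcf Y inferInstance
    exact ⟨_, X, f, hf, rfl⟩
  obtain ⟨X, f, hf, hXn⟩ := wellFounded_lt.min_mem T hT
  have := hsub.1 X hf.1
  refine ⟨X, f, hf, fun h hh => ?_⟩
  obtain ⟨n, hc, hn⟩ := ((LinearMap.eventually_isCompl_ker_pow_range_pow h.hom).and
    (Filter.eventually_ge_atTop 1)).exists
  have hpow : ∀ (m : ℕ) (x : X), f.hom ((h.hom ^ m) x) = f.hom x := by
    intro m
    induction m with
    | zero => exact fun x => rfl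
    | succ m ih =>
      intro x
      rw [pow_succ', Module.End.mul_apply]
      exact (congrArg (fun t : X ⟶ Y => t.hom ((h.hom ^ m) x)) hh).trans (ih x)
  let U := LinearMap.range (h.hom ^ n)
  have hU : RightApprox Ω (ModuleCat.ofHom (f.hom ∘ₗ U.subtype)) := by
    refine ⟨hsub.of_isCompl hf.1 hc.symm, fun Z hZ g => ?_⟩
    obtain ⟨t, rfl⟩ := hf.2 Z hZ g
    refine ⟨ModuleCat.ofHom ((h.hom ^ n).rangeRestrict ∘ₗ t.hom), ?_⟩
    ext z
    exact hpow n (t.hom z)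
  have hle : Module.length A X ≤ Module.length A U := by
    rw [hXn]
    exact not_lt.1 (wellFounded_lt.not_lt_min T ⟨_, _, hU, rfl⟩)
  have htop : U = ⊤ := by
    by_contra hne
    exact hle.not_gt (Submodule.length_lt hne)
  have hsurj : Function.Surjective h.hom := by
    rw [← LinearMap.range_eq_top, eq_top_iff, ← htop]
    rintro _ ⟨x, rfl⟩
    obtain ⟨m, rfl⟩ := Nat.exists_eq_add_of_le' hn
    exact ⟨(h.hom ^ m) x, by rw [pow_succ', Module.End.mul_apply]⟩
  exact (ConcreteCategory.isIso_iff_bijective h).2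
    (IsNoetherian.bijective_of_surjective_endomorphism h.hom hsurj)

end

lemma IsJHLength.length_eq {A : Type} [Ring A] {X : ModuleCat.{0} A} {n : ℕ}
    (h : IsJHLength X n) : Module.length A X = n := by
  obtain ⟨s, h0, h1, rfl⟩ := h
  exact (Module.length_compositionSeries s h0 h1).symm

lemma exists_approx_length_le {A : Type} [Ring A] [IsArtinianRing A]
    {Ω : ModuleCat.{0} A → Prop} (hsub : IsSubcat Ω) (hcf : ContravariantlyFinite Ω)
    (hres : Resolving Ω) (s : ℕ∞)
    (hs : ∀ (S XS : ModuleCat.{0} A) (fS : XS ⟶ S), IsSimpleModule A S →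
      MinimalRightApprox Ω fS → Module.length A XS ≤ s)
    (M : Type) [AddCommGroup M] [Module A M] (hM : IsFiniteLength A M) :
    ∃ (X : ModuleCat.{0} A) (f : X →ₗ[A] M), Ω X ∧ Function.Surjective f ∧
      ExtOrthogonal Ω (LinearMap.ker f) ∧ Module.length A X ≤ Module.length A M * s := by
  induction hM with
  | @of_subsingleton M _ _ _ =>
    refine ⟨ModuleCat.of A M, LinearMap.id, hres.of_subsingleton M, Function.surjective_id,
      .of_subsingleton, ?_⟩
    rw [Module.length_eq_zero_iff.2 ‹Subsingleton M›]
    exact zero_le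
  | @of_simple_quotient M _ _ N _ _ ih =>
    obtain ⟨X', f', hX', hf', hY', hlen⟩ := ih
    obtain ⟨XS, g, hg⟩ := exists_minimalRightApprox hsub hcf (ModuleCat.of A (M ⧸ N))
    have := hsub.1 XS hg.1.1
    obtain ⟨n, p, hp⟩ := Module.Finite.exists_fin' A XS
    have hK : Ω (ModuleCat.of A (LinearMap.ker p)) :=
      hres.2.2 (ModuleCat.of A (Fin n → A)) XS _ (ModuleCat.ofHom p)
        (ModuleCat.ofHom (LinearMap.ker p).subtype) (hres.free n) hg.1.1 hp
        (LinearMap.ker p).injective_subtype (LinearMap.exact_subtype_ker_map p)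
    obtain ⟨X, _, _, j, c, f, hj, hc, hjc, hf, hY⟩ := exists_horseshoe N f' hf' hY' g.hom
      (hg.1.surjective_s1 hres) (hg.extOrthogonal_ker hres.1) p hp hK
    refine ⟨ModuleCat.of A X, f, hres.1 X' (ModuleCat.of A X) XS (ModuleCat.ofHom j)
      (ModuleCat.ofHom c) ⟨hj, hc, hjc⟩ hX' hg.1.1, hf, hY, ?_⟩
    have h1 : Module.length A (M ⧸ N) = 1 := Module.length_eq_one A (M ⧸ N)
    change Module.length A X ≤ _
    rw [Module.length_eq_add_of_exact j c hj hc hjc,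
      Module.length_eq_add_of_exact N.subtype N.mkQ N.injective_subtype N.mkQ_surjective
        (LinearMap.exact_subtype_mkQ N), h1, add_mul, one_mul]
    exact add_le_add hlen (hs _ XS g ‹_› hg)

lemma MinimalRightApprox.length_le {A : Type} [Ring A] {Ω : ModuleCat.{0} A → Prop}
    {X X' M : ModuleCat.{0} A} {f : X ⟶ M} {f' : X' ⟶ M} (hf : MinimalRightApprox Ω f)
    (hf' : RightApprox Ω f') : Module.length A X ≤ Module.length A X' := by
  obtain ⟨a, ha⟩ := hf'.2 X hf.1.1 f
  obtain ⟨b, hb⟩ := hf.1.2 X' hf'.1 f'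
  have := hf.2 (a ≫ b) (by rw [Category.assoc, hb, ha])
  have hinj : Function.Injective (b.hom ∘ a.hom) :=
    (ConcreteCategory.bijective_of_isIso (a ≫ b)).1
  exact Module.length_le_of_injective a.hom hinj.of_comp

/-!
Statement 1: if `X_M` is the domain of a minimal right `Ω`-approximation of `M`, then
`l(X_M) ≤ l(M)·s`, where `s` bounds the lengths of domains of minimal right
`Ω`-approximations of the simple `A`-modules.
-/

theorem stmt_1 {K : Type} [Field K] [IsAlgClosed K]
    {A : Type} [Ring A] [Algebra K A] [FiniteDimensional K A]
    (Ω : ModuleCat.{0} A → Prop)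
    (hsub : IsSubcat Ω) (hff : FunctoriallyFinite Ω) (hres : Resolving Ω)
    -- `len` is the Jordan–Hölder length function
    (len : ModuleCat.{0} A → ℕ)
    (hlen : ∀ X : ModuleCat.{0} A, Module.Finite A X → IsJHLength X (len X))
    -- `s = max { l(X_S) : S simple }`
    (s : ℕ)
    (hs : ∀ (S XS : ModuleCat.{0} A) (fS : XS ⟶ S), IsSimpleModule A S →
      MinimalRightApprox Ω fS → len XS ≤ s)
    (hattained : ∃ (S XS : ModuleCat.{0} A) (fS : XS ⟶ S), IsSimpleModule A S ∧
      MinimalRightApprox Ω fS ∧ len XS = s)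
    (M XM : ModuleCat.{0} A) (hM : Module.Finite A M)
    (fM : XM ⟶ M) (hfM : MinimalRightApprox Ω fM) :
    len XM ≤ len M * s := by
  have : IsArtinianRing A := isArtinian_of_tower K inferInstance
  have hlength : ∀ X : ModuleCat.{0} A, Module.Finite A X → Module.length A X = len X :=
    fun X hX => (hlen X hX).length_eq
  obtain ⟨X, f, hX, hf, hY, hle⟩ := exists_approx_length_le hsub hff.1 hres (s : ℕ∞)
    (fun S XS fS hS hfS => by
      rw [hlength XS (hsub.1 XS hfS.1.1)]
      exact_mod_cast hs S XS fS hS hfS) M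
    (isFiniteLength_iff_isNoetherian_isArtinian.2 ⟨inferInstance, inferInstance⟩)
  have happ : RightApprox Ω (ModuleCat.ofHom f) := ⟨hX, fun Z hZ g => by
    obtain ⟨g', hg'⟩ := hY.exists_lift f hf hZ g.hom
    exact ⟨ModuleCat.ofHom g', by ext z; exact LinearMap.congr_fun hg' z⟩⟩
  have := (hfM.length_le happ).trans hle
  rw [hlength XM (hsub.1 XM hfM.1.1), hlength M hM] at this
  exact_mod_cast this
end

section
/- Let f₁ : X → U, f₂ : X → Y, g₁ : U → Z, g₂ : Y → Z, g₃ : U → V, h₁ : Z → W, h₂ : V → W be morphisms of A-modules such that 0 → X → U ⊕ Y → Z → 0 (with maps x ↦ (f₁x, f₂x) and (u,y) ↦ g₁u + g₂y) and 0 → U → Z ⊕ V → W → 0 (with maps u ↦ (g₁u, g₃u) and (z,v) ↦ h₁z + h₂v) are short exact sequences. Then 0 → X → V ⊕ Y → W → 0, with maps x ↦ (g₃f₁x, f₂x) and (v,y) ↦ −h₂v + h₁g₂y, is a short exact sequence. -/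
/-!
Statement 2: Given short exact sequences
`0 → X → U ⊕ Y → Z → 0` (maps `x ↦ (f₁x, f₂x)` and `(u,y) ↦ g₁u + g₂y`) and
`0 → U → Z ⊕ V → W → 0` (maps `u ↦ (g₁u, g₃u)` and `(z,v) ↦ h₁z + h₂v`),
the sequence `0 → X → V ⊕ Y → W → 0` with maps `x ↦ (g₃f₁x, f₂x)` and
`(v,y) ↦ −h₂v + h₁g₂y` is short exact.
-/

theorem stmt_2 {A : Type*} [Ring A]
    {X U Y Z V W : Type*}
    [AddCommGroup X] [Module A X] [AddCommGroup U] [Module A U]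
    [AddCommGroup Y] [Module A Y] [AddCommGroup Z] [Module A Z]
    [AddCommGroup V] [Module A V] [AddCommGroup W] [Module A W]
    (f₁ : X →ₗ[A] U) (f₂ : X →ₗ[A] Y) (g₁ : U →ₗ[A] Z) (g₂ : Y →ₗ[A] Z)
    (g₃ : U →ₗ[A] V) (h₁ : Z →ₗ[A] W) (h₂ : V →ₗ[A] W)
    (hinj₁ : Function.Injective (f₁.prod f₂))
    (hex₁ : Function.Exact (f₁.prod f₂) (g₁.coprod g₂))
    (hsurj₁ : Function.Surjective (g₁.coprod g₂))
    (hinj₂ : Function.Injective (g₁.prod g₃))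
    (hex₂ : Function.Exact (g₁.prod g₃) (h₁.coprod h₂))
    (hsurj₂ : Function.Surjective (h₁.coprod h₂)) :
    Function.Injective ((g₃ ∘ₗ f₁).prod f₂) ∧
    Function.Exact ((g₃ ∘ₗ f₁).prod f₂) ((-h₂).coprod (h₁ ∘ₗ g₂)) ∧
    Function.Surjective ((-h₂).coprod (h₁ ∘ₗ g₂)) := by
  have hgf (x : X) : g₁ (f₁ x) + g₂ (f₂ x) = 0 := by
    simpa using hex₁.apply_apply_eq_zero x
  have hhg (u : U) : h₁ (g₁ u) + h₂ (g₃ u) = 0 := by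
    simpa using hex₂.apply_apply_eq_zero u
  refine ⟨?_, ?_, ?_⟩
  · rw [injective_iff_map_eq_zero] at hinj₁ hinj₂ ⊢
    intro x hx
    obtain ⟨hx₁, hx₂⟩ : g₃ (f₁ x) = 0 ∧ f₂ x = 0 := by simpa using hx
    have hgx : g₁ (f₁ x) = 0 := by simpa [hx₂] using hgf x
    have hfx : f₁ x = 0 := hinj₂ _ (Prod.ext hgx hx₁)
    exact hinj₁ x (Prod.ext hfx hx₂)
  · rintro ⟨v, y⟩
    constructor
    · intro h
      have hvy : -h₂ v + h₁ (g₂ y) = 0 := by simpa using h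
      obtain ⟨u, hu⟩ := (hex₂ (-g₂ y, v)).1 (by
        rw [← neg_eq_zero, ← hvy]
        simp [add_comm])
      obtain ⟨hu₁, hu₂⟩ : g₁ u = -g₂ y ∧ g₃ u = v := by simpa using hu
      obtain ⟨x, hx⟩ := (hex₁ (u, y)).1 (by simp [hu₁])
      obtain ⟨hx₁, hx₂⟩ : f₁ x = u ∧ f₂ x = y := by simpa using hx
      exact ⟨x, by simp [hx₁, hx₂, hu₂]⟩
    · rintro ⟨x, hx⟩
      obtain ⟨rfl, rfl⟩ : g₃ (f₁ x) = v ∧ f₂ x = y := by simpa using hx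
      have hz : g₂ (f₂ x) = -g₁ (f₁ x) := eq_neg_of_add_eq_zero_right (hgf x)
      simpa [hz, add_comm] using congrArg Neg.neg (hhg (f₁ x))
  · intro w
    obtain ⟨⟨z, v⟩, rfl⟩ := hsurj₂ w
    obtain ⟨⟨u, y⟩, rfl⟩ := hsurj₁ z
    refine ⟨(g₃ u - v, y), ?_⟩
    have hu : h₁ (g₁ u) = -h₂ (g₃ u) := eq_neg_of_add_eq_zero_left (hhg u)
    simp only [LinearMap.coprod_apply, LinearMap.neg_apply, LinearMap.comp_apply, map_sub,
      map_add, hu]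
    abel
end

section
/- Let X and Y be indecomposable finitely generated A-modules and let f : X → Y be an irreducible morphism. Then |l(X) − l(Y)| ≤ l(Y)·m², where m = max{ l(A as a left A-module), l(A as a right A-module) }. -/
open CategoryTheory Limits

universe u

/-!
Statement 3: if `f : X → Y` is an irreducible morphism between indecomposable
finitely generated `A`-modules then `|l(X) − l(Y)| ≤ l(Y)·m²` where
`m = max(l(ₐA), l(Aₐ))`.
-/
/-- The `K`-linear dual of the right `A`-module `ι → A`. -/
def RightDual (K A ι : Type) [Field K] [Ring A] [Algebra K A] : Type :=
  (ι → A) →ₗ[K] K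

namespace RightDual

variable {K A ι : Type} [Field K] [Ring A] [Algebra K A]

instance : AddCommGroup (RightDual K A ι) :=
  inferInstanceAs (AddCommGroup ((ι → A) →ₗ[K] K))

/-- Right multiplication by `a` on `ι → A`, as a `K`-linear map. -/
def mulRight (K : Type) {A : Type} (ι : Type) [Field K] [Ring A] [Algebra K A] (a : A) :
    (ι → A) →ₗ[K] (ι → A) :=
  (LinearMap.mulRight K a).compLeft ι

/-- A functional on `ι → A`, viewed as an element of the dual. -/
def of (ξ : (ι → A) →ₗ[K] K) : RightDual K A ι := ξ

/-- The functional on `ι → A` underlying an element of the dual. -/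
def toLin (ξ : RightDual K A ι) : (ι → A) →ₗ[K] K := ξ

@[simp] lemma toLin_of (ξ : (ι → A) →ₗ[K] K) : (of ξ).toLin = ξ := rfl

@[simp] lemma toLin_add (ξ η : RightDual K A ι) : (ξ + η).toLin = ξ.toLin + η.toLin := rfl

@[simp] lemma toLin_zero : (0 : RightDual K A ι).toLin = 0 := rfl

@[ext] lemma ext {ξ η : RightDual K A ι} (h : ∀ x, ξ.toLin x = η.toLin x) : ξ = η :=
  LinearMap.ext h

instance : SMul A (RightDual K A ι) :=
  ⟨fun a ξ => of (ξ.toLin ∘ₗ mulRight K ι a)⟩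

lemma smul_apply (a : A) (ξ : RightDual K A ι) (x : ι → A) :
    (a • ξ).toLin x = ξ.toLin (fun j => x j * a) := rfl

instance : Module A (RightDual K A ι) where
  one_smul ξ := by ext x; simp [smul_apply]
  mul_smul a b ξ := by ext x; simp [smul_apply, mul_assoc]
  smul_zero a := by ext x; simp [smul_apply]
  smul_add a ξ η := by ext x; simp [smul_apply]
  add_smul a b ξ := by
    ext x
    simp only [smul_apply, toLin_add, LinearMap.add_apply, mul_add]
    exact map_add ξ.toLin (fun j => x j * a) (fun j => x j * b)
  zero_smul ξ := by
    ext x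
    simp only [smul_apply, mul_zero, toLin_zero, LinearMap.zero_apply]
    exact map_zero ξ.toLin

/-- The right submodule of vectors annihilated by a left submodule of the dual. -/
def annihilated (N : Submodule A (RightDual K A ι)) : Submodule Aᵐᵒᵖ (ι → A) where
  carrier := {x | ∀ ξ ∈ N, ξ.toLin x = 0}
  add_mem' hx hy ξ hξ := by rw [map_add, hx ξ hξ, hy ξ hξ, add_zero]
  zero_mem' ξ _ := map_zero _
  smul_mem' a _ hx ξ hξ := hx _ (N.smul_mem a.unop hξ)

/-- A left submodule of the dual, as a `K`-subspace. -/
def toSubspace (N : Submodule A (RightDual K A ι)) : Subspace K (Module.Dual K (ι → A)) where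
  carrier := {ξ | of ξ ∈ N}
  add_mem' hx hy := N.add_mem hx hy
  zero_mem' := N.zero_mem
  smul_mem' c ξ hξ := by
    have h := N.smul_mem (algebraMap K A c) (show of ξ ∈ N from hξ)
    have e : algebraMap K A c • of ξ = of (c • ξ) := by
      ext x
      rw [smul_apply]
      have : (fun j => x j * algebraMap K A c) = c • x := by
        funext j; simp [Algebra.smul_def, Algebra.commutes]
      rw [this]
      simp
    rwa [e] at h

variable [FiniteDimensional K A] [Finite ι]

lemma annihilated_anti_iff {N P : Submodule A (RightDual K A ι)} :
    annihilated N ≤ annihilated P ↔ P ≤ N := by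
  refine ⟨fun h ξ hξ => ?_, fun h x hx ξ hξ => hx ξ (h hξ)⟩
  have key : ξ.toLin ∈ (toSubspace N).dualCoannihilator.dualAnnihilator := by
    rw [Submodule.mem_dualAnnihilator]
    intro x hx
    rw [Submodule.mem_dualCoannihilator] at hx
    exact h (fun η hη => hx η.toLin hη) ξ hξ
  rw [Subspace.dualCoannihilator_dualAnnihilator_eq] at key
  exact key

lemma length_le : Module.length A (RightDual K A ι) ≤ Module.length Aᵐᵒᵖ (ι → A) := by
  rw [← WithBot.coe_le_coe, Module.coe_length, Module.coe_length,
    ← Order.krullDim_orderDual (α := Submodule Aᵐᵒᵖ (ι → A))]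
  refine Order.krullDim_le_of_strictMono (fun N => OrderDual.toDual (annihilated N)) ?_
  intro N P h
  rw [OrderDual.toDual_lt_toDual, lt_iff_le_not_ge, annihilated_anti_iff, annihilated_anti_iff]
  exact lt_iff_le_not_ge.mp h

end RightDual

/-- A module of finite length is generated by at most as many elements as its length. -/
lemma IsFiniteLength.exists_generators {R M : Type} [Ring R] [AddCommGroup M] [Module R M]
    (h : IsFiniteLength R M) :
    ∃ n : ℕ, (n : ℕ∞) ≤ Module.length R M ∧
      ∃ y : Fin n → M, Submodule.span R (Set.range y) = ⊤ := by
  induction h with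
  | of_subsingleton => exact ⟨0, by simp, Fin.elim0, Subsingleton.elim _ _⟩
  | @of_simple_quotient M _ _ N _ _ ih =>
    obtain ⟨n, hn, y, hy⟩ := ih
    have := IsSimpleModule.nontrivial R (M ⧸ N)
    obtain ⟨q, hq⟩ := exists_ne (0 : M ⧸ N)
    obtain ⟨x, rfl⟩ := N.mkQ_surjective q
    have hlen := Module.length_eq_add_of_exact N.subtype N.mkQ N.injective_subtype
      N.mkQ_surjective (LinearMap.exact_subtype_mkQ N)
    rw [Module.length_eq_one R (M ⧸ N)] at hlen
    refine ⟨n + 1, ?_, Fin.cons x (fun j => (y j : M)), ?_⟩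
    · rw [hlen]; push_cast; gcongr
    · have hN : N ≤ Submodule.span R (Set.range (fun j => (y j : M))) := by
        have := congrArg (Submodule.map N.subtype) hy
        rw [Submodule.map_span, ← Set.range_comp, Submodule.map_top, Submodule.range_subtype]
          at this
        exact this.ge
      have hco : IsCoatom N := isSimpleModule_iff_isCoatom.mp inferInstance
      rw [Fin.range_cons]
      refine hco.2 _ (lt_of_le_of_ne (hN.trans (Submodule.span_mono (Set.subset_insert _ _))) ?_)
      intro h
      apply hq
      rw [Submodule.mkQ_apply, Submodule.Quotient.mk_eq_zero, h]
      exact Submodule.subset_span (Set.mem_insert _ _)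

section Extension

variable {K A C X Y : Type} [Field K] [Ring A] [Algebra K A]
  [AddCommGroup C] [Module A C] [Module K C] [IsScalarTower K A C]
  [AddCommGroup X] [Module A X] [AddCommGroup Y] [Module A Y]

/-- The kernel of the map of duals induced by a presentation matrix `r`. -/
def transposeDual (K : Type) {A ι κ : Type} [Field K] [Ring A] [Algebra K A]
    (r : ι → κ → A) : Submodule A (RightDual K A ι) where
  carrier := {ξ | ∀ k a, ξ.toLin (fun j => r j k * a) = 0}
  add_mem' hx hy k a := by simp [hx k a, hy k a]
  zero_mem' k a := by simp
  smul_mem' b ξ hξ k a := by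
    rw [RightDual.smul_apply]; simpa [mul_assoc] using hξ k (a * b)

/-- A section of a surjection `f` onto a module presented by generators `y` with relations `r`
is determined by lifts of the generators satisfying the relations. -/
lemma exists_section_of_relations {n p : ℕ} (f : X →ₗ[A] Y) (y : Fin n → Y)
    (hy : Submodule.span A (Set.range y) = ⊤) (r : Fin p → Fin n → A)
    (hr : Submodule.span A (Set.range r) = LinearMap.ker (Fintype.linearCombination A y))
    (x : Fin n → X) (hx : ∀ k, f (x k) = y k) (hrel : ∀ j, ∑ k, r j k • x k = 0) :
    ∃ s : Y →ₗ[A] X, f ∘ₗ s = LinearMap.id := by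
  have hP : Function.Surjective (Fintype.linearCombination A y) := by
    rw [← LinearMap.range_eq_top, Fintype.range_linearCombination, hy]
  have hker : LinearMap.ker (Fintype.linearCombination A y) ≤
      LinearMap.ker (Fintype.linearCombination A x) := by
    rw [← hr, Submodule.span_le]
    rintro _ ⟨j, rfl⟩
    simpa [Fintype.linearCombination_apply] using hrel j
  refine ⟨Submodule.liftQ _ _ hker ∘ₗ
    (LinearMap.quotKerEquivOfSurjective _ hP).symm.toLinearMap, ?_⟩
  ext w
  obtain ⟨a, rfl⟩ := hP w
  have : (LinearMap.quotKerEquivOfSurjective _ hP).symm (Fintype.linearCombination A y a) =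
      Submodule.Quotient.mk a := by
    rw [LinearEquiv.symm_apply_eq]; rfl
  rw [LinearMap.comp_apply, LinearMap.comp_apply, LinearEquiv.coe_coe, this,
    Submodule.liftQ_apply]
  simp [Fintype.linearCombination_apply, hx]

/-- If `0 → C → X → Y → 0` does not split, then some morphism from `C` to the transpose dual of a
presentation of `Y` does not extend to `X`. -/
lemma exists_not_extends {n p : ℕ} (i : C →ₗ[A] X) (f : X →ₗ[A] Y)
    (hf : Function.Surjective f) (hif : Function.Exact i f)
    (hns : ¬ ∃ s : Y →ₗ[A] X, f ∘ₗ s = LinearMap.id)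
    (y : Fin n → Y) (hy : Submodule.span A (Set.range y) = ⊤) (r : Fin p → Fin n → A)
    (hr : Submodule.span A (Set.range r) = LinearMap.ker (Fintype.linearCombination A y)) :
    ∃ φ : C →ₗ[A] transposeDual K r, ¬ ∃ t : X →ₗ[A] transposeDual K r, t ∘ₗ i = φ := by
  choose x hx using fun k => hf (y k)
  have hz : ∀ j, ∃ c, i c = ∑ k, r j k • x k := by
    intro j
    refine (hif _).mp ?_
    have : r j ∈ LinearMap.ker (Fintype.linearCombination A y) :=
      hr ▸ Submodule.subset_span ⟨j, rfl⟩
    simpa [Fintype.linearCombination_apply, hx] using this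
  choose z hz using hz
  let L : (Fin n → C) →ₗ[K] (Fin p → C) :=
    LinearMap.pi fun j => ∑ k, (Algebra.lsmul K K C (r j k)) ∘ₗ LinearMap.proj k
  have hL : ∀ u j, L u j = ∑ k, r j k • u k := fun u j => by simp [L]
  have hzL : z ∉ LinearMap.range L := by
    rintro ⟨u, hu⟩
    refine hns (exists_section_of_relations f y hy r hr (fun k => x k - i (u k)) ?_ ?_)
    · intro k; simp [hx, hif.apply_apply_eq_zero]
    · intro j
      have := congrArg i (congrFun hu j)
      rw [hL, hz] at this
      simp [smul_sub, ← this]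
  obtain ⟨l, hlz, hlV⟩ := Submodule.exists_le_ker_of_notMem hzL
  let e (c : C) : (Fin p → A) →ₗ[K] (Fin p → C) :=
    ((LinearMap.toSpanSingleton A C c).restrictScalars K).compLeft (Fin p)
  let φ : C →ₗ[A] transposeDual K r :=
    { toFun := fun c => ⟨RightDual.of (l ∘ₗ e c), fun k a => by
        have := hlV ⟨Pi.single k (a • c), rfl⟩
        rw [LinearMap.mem_ker] at this
        rw [← this, RightDual.toLin_of, LinearMap.comp_apply]
        congr 1
        funext j
        rw [hL, Finset.sum_eq_single k] <;> simp +contextual [e, mul_smul]⟩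
      map_add' := fun c d => by
        ext a
        change l (e (c + d) a) = l (e c a) + l (e d a)
        rw [← map_add]
        congr 1
        funext j
        simp [e]
      map_smul' := fun b c => by
        ext a
        change l (e (b • c) a) = l (e c fun j => a j * b)
        congr 1
        funext j
        simp [e, mul_smul] }
  refine ⟨φ, ?_⟩
  rintro ⟨t, ht⟩
  apply hlz
  have h1 : l z = ∑ j, (t (i (z j))).1.toLin (Pi.single j 1) := by
    have hφ : ∀ j, (t (i (z j))).1.toLin (Pi.single j 1) = l (Pi.single j (z j)) := by
      intro j
      have : t (i (z j)) = φ (z j) := LinearMap.congr_fun ht (z j)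
      rw [this]
      change l (e (z j) (Pi.single j 1)) = _
      congr 1
      funext j'
      by_cases h : j' = j
      · subst h; simp [e]
      · simp [e, h]
    simp_rw [hφ]
    rw [← map_sum, Finset.univ_sum_single]
  have h2 : ∀ j, (t (i (z j))).1.toLin (Pi.single j 1) =
      ∑ k, (t (x k)).1.toLin (Pi.single j (r j k)) := by
    intro j
    rw [hz, map_sum]
    simp only [map_smul]
    have hsum : ∀ s : Finset (Fin n), (∑ k ∈ s, r j k • t (x k)).1.toLin (Pi.single j 1) =
        ∑ k ∈ s, (r j k • t (x k)).1.toLin (Pi.single j 1) := by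
      intro s
      induction s using Finset.cons_induction with
      | empty => simp
      | cons k s hk ih => rw [Finset.sum_cons, Finset.sum_cons, ← ih]; rfl
    rw [hsum]
    refine Finset.sum_congr rfl fun k _ => ?_
    change (r j k • (t (x k)).1).toLin _ = _
    rw [RightDual.smul_apply]
    congr 1
    funext j'
    by_cases h : j' = j
    · subst h; simp
    · simp [h]
  rw [h1]
  simp_rw [h2]
  rw [Finset.sum_comm]
  refine Finset.sum_eq_zero fun k _ => ?_
  rw [← map_sum, Finset.univ_sum_single (fun j => r j k)]
  simpa using (t (x k)).2 k 1

end Extension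

/-- If `f` is an irreducible epimorphism with kernel `i : C → X`, then every morphism from `C`
which does not extend along `i` is injective. -/
lemma IrredIn.injective_of_not_extends {A : Type} [Ring A] {X Y : ModuleCat.{0} A} {f : X ⟶ Y}
    (hf : IrredIn (fun Z : ModuleCat.{0} A => Module.Finite A Z) f) [Module.Finite A X]
    {C W : Type} [AddCommGroup C] [Module A C] [AddCommGroup W] [Module A W] [Module.Finite A W]
    (i : C →ₗ[A] X) (hi : Function.Injective i) (hif : Function.Exact i f.hom)
    (φ : C →ₗ[A] W) (hφ : ¬ ∃ t : X →ₗ[A] W, t ∘ₗ i = φ) : Function.Injective φ := by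
  let N : Submodule A (X × W) := LinearMap.range (i.prod (-φ))
  let h : X →ₗ[A] (X × W) ⧸ N := N.mkQ ∘ₗ LinearMap.inl A X W
  let j : W →ₗ[A] (X × W) ⧸ N := N.mkQ ∘ₗ LinearMap.inr A X W
  have hij : ∀ c, h (i c) = j (φ c) := by
    intro c
    rw [← sub_eq_zero]
    change N.mkQ (i c, 0) - N.mkQ (0, φ c) = 0
    rw [← map_sub, Submodule.mkQ_apply, Submodule.Quotient.mk_eq_zero]
    exact ⟨c, by simp⟩
  have hj : Function.Injective j := by
    rw [injective_iff_map_eq_zero]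
    intro w hw
    have hw' : ((0, w) : X × W) ∈ N := (Submodule.Quotient.mk_eq_zero N).mp hw
    obtain ⟨c, hc⟩ := hw'
    obtain ⟨h1, h2⟩ := Prod.ext_iff.mp hc
    have : c = 0 := hi (by simpa using h1)
    subst this
    simpa using h2.symm
  have hN : N ≤ LinearMap.ker (f.hom ∘ₗ LinearMap.fst A X W) := by
    rintro _ ⟨c, rfl⟩
    simp [hif.apply_apply_eq_zero]
  let g : (X × W) ⧸ N →ₗ[A] Y := N.liftQ _ hN
  have hgh : ∀ x, g (h x) = f.hom x := fun x => by simp [g, h]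
  have hker : ∀ q, g q = 0 → q ∈ LinearMap.range j := by
    intro q hq
    obtain ⟨⟨x, w⟩, rfl⟩ := N.mkQ_surjective q
    obtain ⟨c, rfl⟩ := (hif x).mp (by simpa [g] using hq)
    refine ⟨φ c + w, ?_⟩
    rw [map_add, ← hij]
    change N.mkQ (i c, 0) + N.mkQ (0, w) = _
    rw [← map_add]
    simp
  have hfin : Module.Finite A (ModuleCat.of A ((X × W) ⧸ N)) :=
    inferInstanceAs (Module.Finite A ((X × W) ⧸ N))
  rcases hf.2.2 (ModuleCat.of A ((X × W) ⧸ N)) hfin (ModuleCat.ofHom h) (ModuleCat.ofHom g)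
    (by ext x; exact (hgh x).symm) with ⟨⟨⟨s, hs⟩⟩⟩ | ⟨⟨⟨s, hs⟩⟩⟩
  · have hs' : ∀ x, s.hom (h x) = x := fun x => congrArg (fun k => k.hom x) hs
    refine fun c d hcd => hi ?_
    rw [← hs' (i c), hij, hcd, ← hij, hs']
  · have hs' : ∀ w, g (s.hom w) = w := fun w => congrArg (fun k => k.hom w) hs
    exfalso
    let d : X →ₗ[A] (X × W) ⧸ N := h - s.hom ∘ₗ f.hom
    have hd : ∀ x, d x ∈ LinearMap.range j := fun x => hker _ (by simp [d, hgh, hs'])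
    refine hφ ⟨(LinearEquiv.ofInjective j hj).symm.toLinearMap ∘ₗ d.codRestrict _ hd, ?_⟩
    ext c
    rw [LinearMap.comp_apply, LinearMap.comp_apply, LinearEquiv.coe_coe,
      LinearEquiv.symm_apply_eq]
    ext1
    simp [d, hij, hif.apply_apply_eq_zero]

lemma IrredIn.injective_or_surjective {A : Type} [Ring A] {X Y : ModuleCat.{0} A} {f : X ⟶ Y}
    (hf : IrredIn (fun Z : ModuleCat.{0} A => Module.Finite A Z) f) [Module.Finite A X] :
    Function.Injective f.hom ∨ Function.Surjective f.hom := by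
  have hfin : Module.Finite A (ModuleCat.of A (LinearMap.range f.hom)) :=
    inferInstanceAs (Module.Finite A (LinearMap.range f.hom))
  rcases hf.2.2 (ModuleCat.of A (LinearMap.range f.hom)) hfin
    (ModuleCat.ofHom f.hom.rangeRestrict) (ModuleCat.ofHom (LinearMap.range f.hom).subtype)
    (by ext x; rfl) with ⟨⟨⟨s, hs⟩⟩⟩ | ⟨⟨⟨s, hs⟩⟩⟩
  · left
    have hs' : ∀ x, s.hom (f.hom.rangeRestrict x) = x := fun x => congrArg (fun k => k.hom x) hs
    intro x x' h
    rw [← hs' x, ← hs' x']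
    congr 1
    exact Subtype.ext h
  · right
    have hs' : ∀ y, (LinearMap.range f.hom).subtype (s.hom y) = y :=
      fun y => congrArg (fun k => k.hom y) hs
    intro y
    exact hs' y ▸ (s.hom y).2

/-- The kernel of a nonsplit irreducible epimorphism `X → Y` has length at most
`l(Y) · l(ₐA) · l(Aₐ)`. -/
lemma IrredIn.length_ker_le (K : Type) [Field K] {A : Type} [Ring A] [Algebra K A]
    [FiniteDimensional K A] {X Y : ModuleCat.{0} A} {f : X ⟶ Y}
    (hf : IrredIn (fun Z : ModuleCat.{0} A => Module.Finite A Z) f) [Module.Finite A X]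
    [Module.Finite A Y] (hsurj : Function.Surjective f.hom) :
    Module.length A (LinearMap.ker f.hom) ≤
      Module.length A Y * Module.length A A * Module.length Aᵐᵒᵖ A := by
  have : IsArtinianRing A := IsArtinianRing.of_finite K A
  have hArt : IsArtinian Aᵐᵒᵖ A := isArtinian_of_tower K inferInstance
  have hNoeth : IsNoetherian Aᵐᵒᵖ A := isNoetherian_of_tower K inferInstance
  have hY : IsFiniteLength A Y :=
    isFiniteLength_iff_isNoetherian_isArtinian.mpr ⟨inferInstance, inferInstance⟩
  obtain ⟨n, hn, y, hy⟩ := hY.exists_generators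
  have hR : IsFiniteLength A (LinearMap.ker (Fintype.linearCombination A y)) :=
    isFiniteLength_iff_isNoetherian_isArtinian.mpr ⟨inferInstance, inferInstance⟩
  obtain ⟨p, hp, r', hr'⟩ := hR.exists_generators
  let r : Fin p → Fin n → A := fun j => r' j
  have hr : Submodule.span A (Set.range r) = LinearMap.ker (Fintype.linearCombination A y) := by
    have := congrArg (Submodule.map (Submodule.subtype _)) hr'
    rwa [Submodule.map_span, ← Set.range_comp, Submodule.map_top, Submodule.range_subtype] at this
  let _ : Module K X := Module.compHom X (algebraMap K A)
  have : IsScalarTower K A X := ⟨fun a b x => by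
    rw [Algebra.smul_def, mul_smul]; rfl⟩
  have hns : ¬ ∃ s : Y →ₗ[A] X, f.hom ∘ₗ s = LinearMap.id := by
    rintro ⟨s, hs⟩
    exact hf.2.1 ⟨⟨⟨ModuleCat.ofHom s, by ext w; exact LinearMap.congr_fun hs w⟩⟩⟩
  have hDlen : Module.length A (RightDual K A (Fin p)) ≤ p * Module.length Aᵐᵒᵖ A := by
    refine RightDual.length_le.trans ?_
    rw [Module.length_pi]
    simp
  have hD : IsFiniteLength A (RightDual K A (Fin p)) := by
    rw [← Module.length_ne_top_iff]
    refine ne_top_of_le_ne_top ?_ hDlen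
    exact WithTop.mul_ne_top (ENat.natCast_ne_top p) Module.length_ne_top
  have := (isFiniteLength_iff_isNoetherian_isArtinian.mp hD).1
  obtain ⟨φ, hφ⟩ := exists_not_extends (K := K) (LinearMap.ker f.hom).subtype f.hom
    hsurj (LinearMap.exact_subtype_ker_map f.hom) hns y hy r hr
  have hφinj := hf.injective_of_not_extends (LinearMap.ker f.hom).subtype
    (Submodule.injective_subtype _) (LinearMap.exact_subtype_ker_map f.hom) φ hφ
  calc Module.length A (LinearMap.ker f.hom)
      ≤ Module.length A (transposeDual K r) := Module.length_le_of_injective φ hφinj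
    _ ≤ Module.length A (RightDual K A (Fin p)) :=
        Module.length_le_of_injective _ (Submodule.injective_subtype _)
    _ ≤ p * Module.length Aᵐᵒᵖ A := hDlen
    _ ≤ Module.length A Y * Module.length A A * Module.length Aᵐᵒᵖ A := by
        gcongr
        calc (p : ℕ∞) ≤ _ := hp
          _ ≤ Module.length A (Fin n → A) :=
            Module.length_le_of_injective _ (Submodule.injective_subtype _)
          _ = n * Module.length A A := by rw [Module.length_pi]; simp
          _ ≤ _ := by gcongr

theorem stmt_3 {K : Type} [Field K] [IsAlgClosed K]
    {A : Type} [Ring A] [Algebra K A] [FiniteDimensional K A]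
    -- `len` is the Jordan–Hölder length function on left `A`-modules
    (len : ModuleCat.{0} A → ℕ)
    (hlen : ∀ X : ModuleCat.{0} A, Module.Finite A X → IsJHLength X (len X))
    -- `mr` is the Jordan–Hölder length of `A` as a right `A`-module
    (mr : ℕ)
    (hmr : ∃ t : CompositionSeries (Submodule Aᵐᵒᵖ A), t.head = ⊥ ∧ t.last = ⊤ ∧ t.length = mr)
    -- `m = max(l(ₐA), l(Aₐ))`
    (m : ℕ) (hm : m = max (len (ModuleCat.of A A)) mr)
    (X Y : ModuleCat.{0} A)
    (hXfin : Module.Finite A X) (hYfin : Module.Finite A Y)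
    (hXind : Indec X) (hYind : Indec Y)
    (f : X ⟶ Y)
    -- `f` is irreducible in `A`-mod (the category of finitely generated modules)
    (hf : IrredIn (fun Z : ModuleCat.{0} A => Module.Finite A Z) f) :
    |(len X : ℤ) - (len Y : ℤ)| ≤ (len Y : ℤ) * (m : ℤ) ^ 2 := by
  have hX := (hlen X hXfin).length_eq
  have hY := (hlen Y hYfin).length_eq
  have hA : Module.length A A = len (ModuleCat.of A A) :=
    (hlen (ModuleCat.of A A) (inferInstanceAs (Module.Finite A A))).length_eq
  have hA' : Module.length Aᵐᵒᵖ A = mr := by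
    obtain ⟨t, h1, h2, rfl⟩ := hmr
    exact (Module.length_compositionSeries t h1 h2).symm
  have hml : len (ModuleCat.of A A) ≤ m := hm ▸ le_max_left _ _
  have hmr' : mr ≤ m := hm ▸ le_max_right _ _
  rcases hf.injective_or_surjective with hinj | hsurj
  · have hXY : len X ≤ len Y := by
      have := Module.length_le_of_injective f.hom hinj
      rw [hX, hY] at this
      exact_mod_cast this
    have hm1 : 1 ≤ m := by
      have hXnt := hXind.1
      have : Nontrivial A := Module.nontrivial A X
      have : 0 < Module.length A A := Module.length_pos
      rw [hA] at this
      exact le_trans (by exact_mod_cast this) hml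
    have hm2 : len Y ≤ len Y * m ^ 2 := Nat.le_mul_of_pos_right _ (by positivity)
    have hm3 : (len Y : ℤ) ≤ len Y * (m : ℤ) ^ 2 := by exact_mod_cast hm2
    rw [abs_le]
    constructor <;> omega
  · have hadd := Module.length_eq_add_of_exact (LinearMap.ker f.hom).subtype f.hom
      (Submodule.injective_subtype _) hsurj (LinearMap.exact_subtype_ker_map f.hom)
    have hker := hf.length_ker_le K hsurj
    rw [hY, hA, hA'] at hker
    have hbound : len X ≤ len Y * len (ModuleCat.of A A) * mr + len Y := by
      rw [hX, hY] at hadd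
      have : (len X : ℕ∞) ≤ len Y * len (ModuleCat.of A A) * mr + len Y := by
        rw [hadd]; gcongr
      exact_mod_cast this
    have hYX : len Y ≤ len X := by
      have := Module.length_le_of_surjective f.hom hsurj
      rw [hX, hY] at this
      exact_mod_cast this
    have hmm : len Y * len (ModuleCat.of A A) * mr ≤ len Y * m ^ 2 := by
      rw [mul_assoc, sq]; gcongr
    have hmm' : ((len Y * len (ModuleCat.of A A) * mr : ℕ) : ℤ) ≤ len Y * (m : ℤ) ^ 2 := by
      exact_mod_cast hmm
    rw [abs_le]
    constructor <;> omega
end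

section
/- Let Ω be a functorially finite resolving subcategory of A-mod, let X and Y be indecomposable modules in Ω, and suppose f : X → Y is an irreducible morphism in Ω. Then |l(X) − l(Y)| ≤ l(Y)·p, where p = s(1 + m²) − 1, m = max{ l(A as a left A-module), l(A as a right A-module) }, and s = max{ l(X_S) : S a simple A-module } with X_S the domain of a minimal right Ω-approximation of S. -/
open CategoryTheory Limits

universe u

section LengthBounds

/-- The `K`-dual of a `K`-algebra `A`, as a left `A`-module. -/
def RegularDual (K A : Type) [Field K] [Ring A] [Algebra K A] : Type := A →ₗ[K] K

namespace RegularDual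

variable {K A : Type} [Field K] [Ring A] [Algebra K A]

instance : AddCommGroup (RegularDual K A) := inferInstanceAs (AddCommGroup (A →ₗ[K] K))

/-- The underlying linear functional. -/
def toFun (ψ : RegularDual K A) : A →ₗ[K] K := ψ

@[ext] lemma ext {ψ χ : RegularDual K A} (h : ∀ a, ψ.toFun a = χ.toFun a) : ψ = χ :=
  LinearMap.ext (f := ψ) (g := χ) h

instance : Module A (RegularDual K A) where
  smul b ψ := ψ.toFun ∘ₗ LinearMap.mulRight K b
  one_smul ψ := ext fun a => congrArg ψ.toFun (mul_one a)
  mul_smul b c ψ := ext fun a => congrArg ψ.toFun (mul_assoc a b c).symm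
  smul_zero _ := rfl
  smul_add _ _ _ := rfl
  add_smul b c ψ := ext fun a =>
    (congrArg ψ.toFun (mul_add a b c)).trans (map_add ψ.toFun _ _)
  zero_smul ψ := ext fun a => (congrArg ψ.toFun (mul_zero a)).trans (map_zero ψ.toFun)

/-- The common kernel of the functionals in a submodule is a right ideal. -/
def annihilator (N : Submodule A (RegularDual K A)) : Submodule Aᵐᵒᵖ A where
  carrier := {a | ∀ ψ ∈ N, ψ.toFun a = 0}
  zero_mem' ψ _ := map_zero ψ.toFun
  add_mem' ha hb ψ hψ := by rw [map_add, ha ψ hψ, hb ψ hψ, add_zero]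
  smul_mem' b a ha ψ hψ := ha (b.unop • ψ) (N.smul_mem _ hψ)

/-- The `K`-subspace of the dual underlying a submodule. -/
def toSubspace (N : Submodule A (RegularDual K A)) : Subspace K (Module.Dual K A) where
  carrier := {ψ | (show RegularDual K A from ψ) ∈ N}
  zero_mem' := N.zero_mem
  add_mem' := N.add_mem
  smul_mem' c ψ hψ := by
    have h : (show RegularDual K A from c • ψ) =
        algebraMap K A c • (show RegularDual K A from ψ) := by
      ext a
      change c • ψ a = ψ (a * algebraMap K A c)
      rw [← Algebra.commutes, ← Algebra.smul_def, map_smul]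
    exact (congrArg (· ∈ N) h).mpr (N.smul_mem _ hψ)

variable [FiniteDimensional K A]

lemma annihilator_le_iff {N N' : Submodule A (RegularDual K A)} :
    annihilator N ≤ annihilator N' ↔ N' ≤ N := by
  refine ⟨fun h ψ hψ => ?_, fun h a ha ψ hψ => ha ψ (h hψ)⟩
  have key : (toSubspace N).dualCoannihilator ≤ (toSubspace N').dualCoannihilator := by
    intro a ha
    rw [Submodule.mem_dualCoannihilator] at ha ⊢
    exact fun φ hφ => h (show a ∈ annihilator N from ha) φ hφ
  have := Submodule.dualAnnihilator_anti key
  rw [Subspace.dualCoannihilator_dualAnnihilator_eq,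
    Subspace.dualCoannihilator_dualAnnihilator_eq] at this
  exact this hψ

lemma length_le : Module.length A (RegularDual K A) ≤ Module.length Aᵐᵒᵖ A := by
  have h : StrictMono
      fun N : (Submodule A (RegularDual K A))ᵒᵈ => annihilator (OrderDual.ofDual N) :=
    fun N N' h => lt_of_le_not_ge (annihilator_le_iff.2 h.le) fun h' =>
      h.not_ge (annihilator_le_iff.1 h')
  have := Order.krullDim_le_of_strictMono _ h
  rwa [Order.krullDim_orderDual, ← Module.coe_length, ← Module.coe_length,
    WithBot.coe_le_coe] at this

end RegularDual

/-- A module of length at most `n` is generated by `n` elements. -/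
lemma exists_span_range_eq_top_of_length_le {A : Type} [Ring A] (n : ℕ) :
    ∀ (M : Type) [AddCommGroup M] [Module A M], Module.length A M ≤ n →
      ∃ v : Fin n → M, Submodule.span A (Set.range v) = ⊤ := by
  induction n with
  | zero =>
    intro M _ _ h
    have : Subsingleton M := Module.length_eq_zero_iff.1 (by simpa using h)
    exact ⟨0, Subsingleton.elim _ _⟩
  | succ n ih =>
    intro M _ _ h
    rcases subsingleton_or_nontrivial M with _ | _
    · exact ⟨0, Subsingleton.elim _ _⟩
    obtain ⟨x, hx⟩ := exists_ne (0 : M)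
    let P := Submodule.span A {x}
    have hP : Module.length A M = Module.length A P + Module.length A (M ⧸ P) :=
      Module.length_eq_add_of_exact P.subtype P.mkQ P.injective_subtype P.mkQ_surjective
        (LinearMap.exact_subtype_mkQ P)
    have : Nontrivial P := ⟨⟨x, Submodule.mem_span_singleton_self x⟩, 0,
      fun h => hx (congrArg Subtype.val h)⟩
    have h1 : 1 ≤ Module.length A P := Order.one_le_iff_pos.2 Module.length_pos
    have h2 : Module.length A (M ⧸ P) ≤ n := by
      have h3 : Module.length A (M ⧸ P) + 1 ≤ n + 1 := by
        calc _ ≤ Module.length A (M ⧸ P) + Module.length A P := by gcongr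
          _ ≤ _ := by rw [add_comm, ← hP]; exact_mod_cast h
      exact (ENat.add_le_add_iff_right ENat.one_ne_top).1 h3
    obtain ⟨v, hv⟩ := ih _ h2
    choose w hw using fun i => P.mkQ_surjective (v i)
    refine ⟨Fin.cons x w, ?_⟩
    rw [Fin.range_cons, Submodule.span_insert]
    have hmap : (Submodule.span A (Set.range w)).map P.mkQ = ⊤ := by
      rw [Submodule.map_span, ← Set.range_comp, ← hv]
      congr 2
      exact funext hw
    have := congrArg (Submodule.comap P.mkQ) hmap
    rwa [Submodule.comap_map_mkQ, Submodule.comap_top] at this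

/-- A surjection `f : X → Y` without a section factors through a surjection `X ⧸ N → Y` without
a section such that the length of `X ⧸ N` is bounded in terms of the length of `Y`. -/
lemma exists_quotient_no_section {K A : Type} [Field K] [Ring A] [Algebra K A]
    [FiniteDimensional K A] {X Y : Type} [AddCommGroup X] [Module A X] [AddCommGroup Y] [Module A Y]
    [Module.Finite A X] (f : X →ₗ[A] Y) (hf : Function.Surjective f)
    (hsec : ¬ ∃ σ : Y →ₗ[A] X, f ∘ₗ σ = LinearMap.id)
    (a b c : ℕ) (ha : Module.length A A ≤ a) (hb : Module.length Aᵐᵒᵖ A ≤ b)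
    (hc : Module.length A Y ≤ c) :
    ∃ (N : Submodule A X) (hN : N ≤ LinearMap.ker f),
      (¬ ∃ σ : Y →ₗ[A] X ⧸ N, N.liftQ f hN ∘ₗ σ = LinearMap.id) ∧
      Module.length A (X ⧸ N) ≤ Module.length A Y + (c * a * b : ℕ) := by
  have : IsArtinianRing A := IsArtinianRing.of_finite K A
  let _ : Module K X := Module.compHom X (algebraMap K A)
  have : IsScalarTower K A X := IsScalarTower.of_algebraMap_smul fun _ _ => rfl
  obtain ⟨y, hy⟩ := exists_span_range_eq_top_of_length_le c Y hc
  let π : (Fin c → A) →ₗ[A] Y := Fintype.linearCombination A y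
  have hπ : Function.Surjective π := by
    rw [← LinearMap.range_eq_top, Fintype.range_linearCombination, hy]
  have hlenR : Module.length A (LinearMap.ker π) ≤ (c * a : ℕ) := by
    refine (Module.length_le_of_injective _ (LinearMap.ker π).injective_subtype).trans ?_
    rw [Module.length_pi]
    push_cast
    simpa using mul_le_mul_right ha (c : ℕ∞)
  obtain ⟨r, hr⟩ := exists_span_range_eq_top_of_length_le (c * a) _ hlenR
  choose x hx using fun i => hf (y i)
  let L := LinearMap.ker f
  let ρ : (Fin c → A) →ₗ[A] X := Fintype.linearCombination A x
  have hρ : ∀ t, f (ρ t) = π t := fun t => by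
    simp [ρ, π, Fintype.linearCombination_apply, hx]
  let δ : Fin (c * a) → L := fun j => ⟨ρ (r j).1, by
    rw [LinearMap.mem_ker, hρ]; exact (r j).2⟩
  let μ : (Fin c → L) →ₗ[K] (Fin (c * a) → L) := LinearMap.pi fun j =>
    ∑ i, (r j).1 i • LinearMap.proj i
  have hμ : ∀ l j, μ l j = ∑ i, (r j).1 i • l i := fun l j => by
    simp [μ]
  have hδ : δ ∉ LinearMap.range μ := by
    rintro ⟨l, hl⟩
    apply hsec
    let τ : (Fin c → A) →ₗ[A] X := ρ - Fintype.linearCombination A fun i => (l i : X)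
    have hτ : LinearMap.ker π ≤ LinearMap.ker τ := by
      have h : Submodule.span A (Set.range r) ≤
          (LinearMap.ker τ).comap (LinearMap.ker π).subtype := by
        rw [Submodule.span_le]
        rintro _ ⟨j, rfl⟩
        have := congrArg Subtype.val (congrFun hl j)
        rw [hμ] at this
        simp only [SetLike.mem_coe, Submodule.mem_comap, Submodule.subtype_apply,
          LinearMap.mem_ker, τ, LinearMap.sub_apply, Fintype.linearCombination_apply, sub_eq_zero]
        simpa [δ] using this.symm
      rw [hr] at h
      exact fun t ht => h (x := ⟨t, ht⟩) trivial
    refine ⟨(LinearMap.ker π).liftQ τ hτ ∘ₗ (π.quotKerEquivOfSurjective hπ).symm, ?_⟩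
    ext z
    obtain ⟨t, rfl⟩ := hπ z
    have h0 : (π.quotKerEquivOfSurjective hπ).symm (π t) = Submodule.Quotient.mk t := by
      rw [LinearEquiv.symm_apply_eq]; rfl
    have h1 : f (Fintype.linearCombination A (fun i => (l i : X)) t) = 0 := by
      rw [Fintype.linearCombination_apply, map_sum]
      exact Finset.sum_eq_zero fun i _ => by rw [map_smul, (l i).2, smul_zero]
    simp [h0, τ, hρ, h1]
  obtain ⟨φ, hφδ, hφ⟩ := Submodule.exists_le_ker_of_notMem hδ
  let u : L →ₗ[A] (Fin (c * a) → RegularDual K A) :=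
    { toFun l j := (φ ∘ₗ LinearMap.single K (fun _ => L) j ∘ₗ
        (LinearMap.toSpanSingleton A L l).restrictScalars K : A →ₗ[K] K)
      map_add' l l' := funext fun j => RegularDual.ext fun t => by
        change φ (Pi.single j (t • (l + l'))) = φ (Pi.single j (t • l)) + φ (Pi.single j (t • l'))
        rw [smul_add, Pi.single_add, map_add]
      map_smul' s l := funext fun j => RegularDual.ext fun t => by
        change φ (Pi.single j (t • s • l)) = φ (Pi.single j ((t * s) • l))
        rw [mul_smul] }
  have hu : ∀ l ∈ LinearMap.ker u, ∀ j, φ (Pi.single j l) = 0 := fun l hl j => by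
    have h : (u l j).toFun 1 = φ (Pi.single j ((1 : A) • l)) := rfl
    rw [one_smul] at h
    rw [← h, LinearMap.mem_ker.1 hl]
    rfl
  let N : Submodule A X := (LinearMap.ker u).map L.subtype
  have hN : N ≤ L := Submodule.map_subtype_le _ _
  refine ⟨N, hN, ?_, ?_⟩
  · rintro ⟨σ, hσ⟩
    choose x' hx' using fun i => N.mkQ_surjective (σ (y i))
    have hfx' : ∀ i, f (x' i) = y i := fun i => by
      have := LinearMap.congr_fun hσ (y i)
      rwa [LinearMap.comp_apply, ← hx'] at this
    let l : Fin c → L := fun i => ⟨x i - x' i, by simp [L, hx, hfx']⟩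
    have hmem : ∀ j, δ j - μ l j ∈ LinearMap.ker u := fun j => by
      have h1 : ((δ j - μ l j : L) : X) = ∑ i, (r j).1 i • x' i := by
        simp [hμ, δ, l, ρ, Fintype.linearCombination_apply, smul_sub]
      have h2 : ((δ j - μ l j : L) : X) ∈ N := by
        rw [h1, ← Submodule.Quotient.mk_eq_zero, ← Submodule.mkQ_apply, map_sum]
        simp only [map_smul, hx']
        rw [← (σ).map_zero, ← (show π (r j).1 = 0 from (r j).2), Fintype.linearCombination_apply,
          map_sum]
        simp
      obtain ⟨l', hl', h'⟩ := h2
      rwa [← Subtype.ext (a1 := l') h']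
    apply hφδ
    have h0 : φ (μ l) = 0 := hφ ⟨l, rfl⟩
    have h1 : φ (δ - μ l) = 0 := by
      rw [← Finset.univ_sum_single (δ - μ l), map_sum]
      exact Finset.sum_eq_zero fun j _ => hu _ (hmem j) j
    rwa [map_sub, h0, sub_zero] at h1
  · have e1 : Module.length A X = Module.length A N + Module.length A (X ⧸ N) :=
      Module.length_eq_add_of_exact N.subtype N.mkQ N.injective_subtype N.mkQ_surjective
        (LinearMap.exact_subtype_mkQ N)
    have e2 : Module.length A X = Module.length A L + Module.length A Y :=
      Module.length_eq_add_of_exact L.subtype f L.injective_subtype hf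
        (LinearMap.exact_subtype_ker_map f)
    have e3 : Module.length A L = Module.length A (LinearMap.ker u) +
        Module.length A (LinearMap.range u) :=
      Module.length_eq_add_of_exact (LinearMap.ker u).subtype u.rangeRestrict
        (LinearMap.ker u).injective_subtype u.surjective_rangeRestrict
        (by rw [LinearMap.exact_iff, LinearMap.ker_rangeRestrict, Submodule.range_subtype])
    have e4 : Module.length A N = Module.length A (LinearMap.ker u) :=
      (Submodule.equivMapOfInjective _ L.injective_subtype _).symm.length_eq
    have e5 : Module.length A (LinearMap.range u) ≤ (c * a * b : ℕ) := by
      refine (Module.length_le_of_injective _ (LinearMap.range u).injective_subtype).trans ?_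
      rw [Module.length_pi]
      push_cast
      simpa using mul_le_mul_right (RegularDual.length_le.trans hb) ((c : ℕ∞) * a)
    have e6 : Module.length A N + Module.length A (X ⧸ N) =
        Module.length A N + (Module.length A Y + Module.length A (LinearMap.range u)) := by
      rw [← e1, e2, e3, e4]; ring
    rw [ENat.add_right_injective_of_ne_top (Module.length_ne_top (R := A) (M := N)) e6]
    gcongr

end LengthBounds

section Approximations

variable {A : Type} [Ring A]

/-- Linear form of `RightApprox`. -/
lemma rightApprox_ofHom_iff {Ω : ModuleCat.{0} A → Prop} {U M : Type} [AddCommGroup U] [Module A U]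
    [AddCommGroup M] [Module A M] (φ : U →ₗ[A] M) :
    RightApprox Ω (ModuleCat.ofHom φ) ↔ Ω (ModuleCat.of A U) ∧
      ∀ (Z : Type) [AddCommGroup Z] [Module A Z], Ω (ModuleCat.of A Z) → ∀ g : Z →ₗ[A] M,
        ∃ h : Z →ₗ[A] U, φ ∘ₗ h = g := by
  refine and_congr_right fun _ => ⟨fun h Z _ _ hZ g => ?_, fun h Z hZ g => ?_⟩
  · obtain ⟨k, hk⟩ := h _ hZ (ModuleCat.ofHom g)
    exact ⟨k.hom, congrArg ModuleCat.Hom.hom hk⟩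
  · obtain ⟨k, hk⟩ := h Z hZ g.hom
    exact ⟨ModuleCat.ofHom k, ModuleCat.hom_ext hk⟩

/-- Linear form of `RightMinimal`. -/
lemma rightMinimal_ofHom_iff {U M : Type} [AddCommGroup U] [Module A U]
    [AddCommGroup M] [Module A M] (φ : U →ₗ[A] M) :
    RightMinimal (ModuleCat.ofHom φ) ↔
      ∀ h : U →ₗ[A] U, φ ∘ₗ h = φ → Function.Bijective h := by
  refine ⟨fun H h hh => ?_, fun H h hh => ?_⟩
  · have := H (ModuleCat.ofHom h) (ModuleCat.hom_ext hh)
    exact ConcreteCategory.bijective_of_isIso (ModuleCat.ofHom h)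
  · exact (ConcreteCategory.isIso_iff_bijective h).2
      (H h.hom (congrArg ModuleCat.Hom.hom hh))

lemma IsSubcat.of_linearEquiv {Ω : ModuleCat.{0} A → Prop} (hΩ : IsSubcat Ω) {U V : Type}
    [AddCommGroup U] [Module A U] [AddCommGroup V] [Module A V] (e : U ≃ₗ[A] V)
    (hU : Ω (ModuleCat.of A U)) : Ω (ModuleCat.of A V) :=
  hΩ.2.1 _ _ e.toModuleIso hU

lemma IsSubcat.of_isCompl_s4 {Ω : ModuleCat.{0} A → Prop} (hΩ : IsSubcat Ω) {U : Type}
    [AddCommGroup U] [Module A U] {P Q : Submodule A U} (h : IsCompl P Q)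
    (hU : Ω (ModuleCat.of A U)) : Ω (ModuleCat.of A P) :=
  hΩ.2.2.2 _ _ _ ((P.prodEquivOfIsCompl Q h).symm.toModuleIso ≪≫
    (ModuleCat.biprodIsoProd (ModuleCat.of A P) (ModuleCat.of A Q)).symm) hU

/-- A right approximation by a resolving subcategory is surjective. -/
lemma RightApprox.surjective_s4 {Ω : ModuleCat.{0} A → Prop} (hres : Resolving Ω) {U M : Type}
    [AddCommGroup U] [Module A U] [AddCommGroup M] [Module A M] (φ : U →ₗ[A] M)
    (hφ : RightApprox Ω (ModuleCat.ofHom φ)) : Function.Surjective φ := fun x => by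
  obtain ⟨h, hh⟩ := ((rightApprox_ofHom_iff φ).1 hφ).2 A hres.2.1 (LinearMap.toSpanSingleton A M x)
  exact ⟨h 1, by simpa using LinearMap.congr_fun hh 1⟩

variable [IsArtinianRing A]

/-- A right approximation can be replaced by a minimal one that is not longer. -/
lemma RightApprox.exists_minimal {Ω : ModuleCat.{0} A → Prop} (hΩ : IsSubcat Ω) {U M : Type}
    [AddCommGroup U] [Module A U] [AddCommGroup M] [Module A M] (φ : U →ₗ[A] M)
    (hφ : RightApprox Ω (ModuleCat.ofHom φ)) :
    ∃ (V : ModuleCat.{0} A) (ψ : V →ₗ[A] M), MinimalRightApprox Ω (ModuleCat.ofHom ψ) ∧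
      Module.length A V ≤ Module.length A U := by
  let S : Set ℕ∞ := {n | ∃ (V : ModuleCat.{0} A) (ψ : V →ₗ[A] M),
    RightApprox Ω (ModuleCat.ofHom ψ) ∧ Module.length A V = n}
  have hS : Module.length A U ∈ S := ⟨ModuleCat.of A U, φ, hφ, rfl⟩
  obtain ⟨V, ψ, hψ, hV⟩ := csInf_mem (⟨_, hS⟩ : S.Nonempty)
  refine ⟨V, ψ, ⟨hψ, (rightMinimal_ofHom_iff ψ).2 fun h hh => ?_⟩, hV ▸ sInf_le hS⟩
  have : Module.Finite A V := hΩ.1 _ hψ.1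
  obtain ⟨n, hn⟩ := Filter.eventually_atTop.1 (LinearMap.eventually_isCompl_ker_pow_range_pow h)
  have hc := hn (n + 1) n.le_succ
  have hpow : ∀ k, ψ ∘ₗ (h ^ k) = ψ := fun k => by
    induction k with
    | zero => rfl
    | succ k ih => rw [pow_succ', Module.End.mul_eq_comp, ← LinearMap.comp_assoc, hh, ih]
  let W := LinearMap.range (h ^ (n + 1))
  have hψ' := (rightApprox_ofHom_iff ψ).1 hψ
  have hW : RightApprox Ω (ModuleCat.ofHom (ψ ∘ₗ W.subtype)) := by
    refine (rightApprox_ofHom_iff _).2 ⟨hΩ.of_isCompl_s4 hc.symm hψ.1, fun Z _ _ hZ g => ?_⟩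
    obtain ⟨k, rfl⟩ := hψ'.2 Z hZ g
    exact ⟨(h ^ (n + 1)).rangeRestrict ∘ₗ k, by
      conv_rhs => rw [← hpow (n + 1)]
      rfl⟩
  have hle : Module.length A V ≤ Module.length A W :=
    hV ▸ sInf_le ⟨ModuleCat.of A W, _, hW, rfl⟩
  have htop : W = ⊤ := by
    by_contra hne
    exact (Submodule.length_lt hne).not_ge hle
  have hsurj : Function.Surjective h := by
    have := LinearMap.range_eq_top.1 htop
    rw [pow_succ'] at this
    exact Function.Surjective.of_comp (g := ⇑(h ^ n)) this
  exact IsNoetherian.bijective_of_surjective_endomorphism h hsurj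

/-- Horseshoe lemma for right approximations. -/
lemma RightApprox.exists_of_exact {Ω : ModuleCat.{0} A → Prop} (hΩ : IsSubcat Ω)
    (hcf : ContravariantlyFinite Ω) (hres : Resolving Ω) {M : Type}
    [AddCommGroup M] [Module A M] [Module.Finite A M] (P : Submodule A M)
    {X₁ X₂ : Type} [AddCommGroup X₁] [Module A X₁] [AddCommGroup X₂] [Module A X₂]
    (φ₁ : X₁ →ₗ[A] P) (φ₂ : X₂ →ₗ[A] M ⧸ P)
    (h₁ : MinimalRightApprox Ω (ModuleCat.ofHom φ₁)) (h₂ : RightApprox Ω (ModuleCat.ofHom φ₂)) :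
    ∃ (E : ModuleCat.{0} A) (ψ : E →ₗ[A] M), RightApprox Ω (ModuleCat.ofHom ψ) ∧
      Module.length A E = Module.length A X₁ + Module.length A X₂ := by
  have : Module.Finite A X₂ := hΩ.1 _ h₂.1
  have h₁' := (rightApprox_ofHom_iff φ₁).1 h₁.1
  have h₂' := (rightApprox_ofHom_iff φ₂).1 h₂
  have hmin := (rightMinimal_ofHom_iff φ₁).1 h₁.2
  -- the pullback of `M → M ⧸ P` along `φ₂`
  let N : Submodule A (M × X₂) :=
    LinearMap.eqLocus (P.mkQ ∘ₗ LinearMap.fst A M X₂) (φ₂ ∘ₗ LinearMap.snd A M X₂)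
  obtain ⟨W, ω, hω⟩ := hcf (ModuleCat.of A N) (inferInstanceAs (Module.Finite A N))
  obtain ⟨w, rfl⟩ : ∃ w : W →ₗ[A] N, ω = ModuleCat.ofHom w := ⟨ω.hom, rfl⟩
  have hw := (rightApprox_ofHom_iff w).1 hω
  have hwsurj := RightApprox.surjective_s4 hres w hω
  let pM : N →ₗ[A] M := LinearMap.fst A M X₂ ∘ₗ N.subtype
  let pX : N →ₗ[A] X₂ := LinearMap.snd A M X₂ ∘ₗ N.subtype
  have hN : ∀ n : N, P.mkQ (pM n) = φ₂ (pX n) := fun n => n.2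
  have hpX : Function.Surjective pX := fun x => by
    obtain ⟨m, hm⟩ := P.mkQ_surjective (φ₂ x)
    exact ⟨⟨(m, x), hm⟩, rfl⟩
  let q : W →ₗ[A] X₂ := pX ∘ₗ w
  have hq : Function.Surjective q := hpX.comp hwsurj
  let U := LinearMap.ker q
  have hU : Ω (ModuleCat.of A U) :=
    hres.2.2 W (ModuleCat.of A X₂) (ModuleCat.of A U) (ModuleCat.ofHom q)
      (ModuleCat.ofHom U.subtype) hw.1 h₂'.1 hq U.injective_subtype
      (LinearMap.exact_subtype_ker_map q)
  let φ : U →ₗ[A] P := (pM ∘ₗ w ∘ₗ U.subtype).codRestrict P fun t => by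
    rw [← P.ker_mkQ, LinearMap.mem_ker]
    have h : pX (w t.1) = 0 := t.2
    exact (hN (w t.1)).trans (by rw [h, map_zero])
  -- `φ` is a right approximation of `P`; compare it with `φ₁`
  obtain ⟨r, hr⟩ := h₁'.2 U hU φ
  obtain ⟨i, hi⟩ : ∃ i : X₁ →ₗ[A] U, φ ∘ₗ i = φ₁ := by
    let j : X₁ →ₗ[A] N := (LinearMap.inl A M X₂ ∘ₗ P.subtype ∘ₗ φ₁).codRestrict N fun t => by
      simp [N, LinearMap.mem_eqLocus]
    obtain ⟨k, hk⟩ := hw.2 X₁ h₁'.1 j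
    have hk' : ∀ t, w (k t) = j t := LinearMap.congr_fun hk
    refine ⟨k.codRestrict U fun t => ?_, ?_⟩
    · change pX (w (k t)) = 0
      rw [hk']; rfl
    · ext t
      change pM (w (k t)) = φ₁ t
      rw [hk']; rfl
  have hrsurj : Function.Surjective r := by
    have h := (hmin (r ∘ₗ i) (by rw [← LinearMap.comp_assoc, hr, hi])).2
    exact Function.Surjective.of_comp (g := ⇑i) h
  let D : Submodule A W := (LinearMap.ker r).map U.subtype
  have hDU : D ≤ U := Submodule.map_subtype_le _ _
  have hDw : D ≤ LinearMap.ker w := by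
    rintro _ ⟨t, ht, rfl⟩
    have h1 : φ t = 0 := by rw [← hr, LinearMap.comp_apply, LinearMap.mem_ker.1 ht, map_zero]
    have h2 : pX (w t.1) = 0 := t.2
    exact Subtype.ext (Prod.ext (congrArg Subtype.val h1) h2)
  let ε : W ⧸ D →ₗ[A] N := D.liftQ w hDw
  let β : W ⧸ D →ₗ[A] X₂ := pX ∘ₗ ε
  have hβ : Function.Surjective β := fun x => by
    obtain ⟨t, rfl⟩ := hq x
    exact ⟨D.mkQ t, rfl⟩
  have hker : LinearMap.ker r = LinearMap.ker (D.mkQ ∘ₗ U.subtype) := by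
    rw [LinearMap.ker_comp, Submodule.ker_mkQ, Submodule.comap_map_eq_of_injective
      U.injective_subtype]
  let α : X₁ →ₗ[A] W ⧸ D := (LinearMap.ker r).liftQ (D.mkQ ∘ₗ U.subtype) hker.le ∘ₗ
    (r.quotKerEquivOfSurjective hrsurj).symm
  have hα : ∀ t, α (r t) = D.mkQ t.1 := fun t => by
    have h0 : (r.quotKerEquivOfSurjective hrsurj).symm (r t) = Submodule.Quotient.mk t := by
      rw [LinearEquiv.symm_apply_eq]; rfl
    simp [α, h0]
  have hαinj : Function.Injective α := by
    rw [injective_iff_map_eq_zero]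
    intro z hz
    obtain ⟨t, rfl⟩ := hrsurj z
    rw [hα] at hz
    exact LinearMap.mem_ker.1 (hker ▸ hz : t ∈ LinearMap.ker r)
  have hexact : Function.Exact α β := by
    intro z
    obtain ⟨t, rfl⟩ := D.mkQ_surjective z
    constructor
    · intro ht
      exact ⟨r ⟨t, ht⟩, hα _⟩
    · rintro ⟨z, hz⟩
      obtain ⟨t', rfl⟩ := hrsurj z
      rw [← hz, hα]
      exact t'.2
  have hE : Ω (ModuleCat.of A (W ⧸ D)) :=
    hres.1 (ModuleCat.of A X₁) (ModuleCat.of A (W ⧸ D)) (ModuleCat.of A X₂)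
      (ModuleCat.ofHom α) (ModuleCat.ofHom β) ⟨hαinj, hβ, hexact⟩ h₁'.1 h₂'.1
  refine ⟨ModuleCat.of A (W ⧸ D), pM ∘ₗ ε, (rightApprox_ofHom_iff _).2 ⟨hE, ?_⟩,
    Module.length_eq_add_of_exact α β hαinj hβ hexact⟩
  intro Z _ _ hZ g
  obtain ⟨k, hk⟩ := h₂'.2 Z hZ (P.mkQ ∘ₗ g)
  obtain ⟨k', hk'⟩ := hw.2 Z hZ ((g.prod k).codRestrict N fun z =>
    (LinearMap.congr_fun hk z).symm)
  refine ⟨D.mkQ ∘ₗ k', ?_⟩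
  ext z
  exact congrArg pM (LinearMap.congr_fun hk' z)

/-- If minimal right approximations of simple modules have length at most `s`, then every finitely
generated module `M` has a right approximation of length at most `s` times the length of `M`. -/
lemma exists_rightApprox_length_le {Ω : ModuleCat.{0} A → Prop} (hΩ : IsSubcat Ω)
    (hcf : ContravariantlyFinite Ω) (hres : Resolving Ω) (s : ℕ)
    (hs : ∀ (S X : ModuleCat.{0} A) (φ : X ⟶ S), IsSimpleModule A S →
      MinimalRightApprox Ω φ → Module.length A X ≤ s) (n : ℕ) :
    ∀ (M : Type) [AddCommGroup M] [Module A M] [Module.Finite A M], Module.length A M = n →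
      ∃ (X : ModuleCat.{0} A) (φ : X →ₗ[A] M), RightApprox Ω (ModuleCat.ofHom φ) ∧
        Module.length A X ≤ (s * n : ℕ) := by
  induction n with
  | zero =>
    intro M _ _ _ h
    have : Subsingleton M := Module.length_eq_zero_iff.1 (by simpa using h)
    have h0 : Ω (ModuleCat.of A PUnit) :=
      hΩ.of_linearEquiv (LinearEquiv.ofSubsingleton (⊥ : Submodule A A) PUnit)
        (hΩ.of_isCompl_s4 (isCompl_bot_top) hres.2.1)
    refine ⟨ModuleCat.of A PUnit, 0, (rightApprox_ofHom_iff _).2 ⟨h0, fun Z _ _ _ g =>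
      ⟨0, Subsingleton.elim _ _⟩⟩, ?_⟩
    exact (Module.length_eq_zero (R := A) (M := PUnit)).trans_le zero_le
  | succ n ih =>
    intro M _ _ _ h
    have : Nontrivial M := Module.length_pos_iff.1 (by rw [h]; exact_mod_cast n.succ_pos)
    obtain ⟨P, hP⟩ := IsCoatomic.exists_coatom (Submodule A M)
    have hsimple : IsSimpleModule A (M ⧸ P) := isSimpleModule_iff_isCoatom.2 hP
    have hlen : Module.length A M = Module.length A P + Module.length A (M ⧸ P) :=
      Module.length_eq_add_of_exact P.subtype P.mkQ P.injective_subtype P.mkQ_surjective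
        (LinearMap.exact_subtype_mkQ P)
    rw [Module.length_eq_one A (M ⧸ P), h] at hlen
    have hPn : Module.length A P = n :=
      ENat.add_left_injective_of_ne_top ENat.one_ne_top (by simpa using hlen.symm)
    obtain ⟨X, φ, hφ, hX⟩ := ih P hPn
    obtain ⟨X₁, φ₁, h₁, hX₁⟩ := hφ.exists_minimal hΩ
    obtain ⟨X', φ', h'⟩ := hcf (ModuleCat.of A (M ⧸ P)) (inferInstanceAs (Module.Finite A (M ⧸ P)))
    obtain ⟨X₂, φ₂, h₂, -⟩ := RightApprox.exists_minimal hΩ φ'.hom h'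
    obtain ⟨E, ψ, hψ, hE⟩ := RightApprox.exists_of_exact hΩ hcf hres P φ₁ φ₂ h₁ h₂.1
    refine ⟨E, ψ, hψ, ?_⟩
    have := hs _ _ _ hsimple h₂
    calc _ = Module.length A X₁ + Module.length A X₂ := hE
      _ ≤ (s * n : ℕ) + s := add_le_add (hX₁.trans hX) this
      _ = _ := by push_cast; ring

end Approximations

/-- If an irreducible morphism `f : X → Y` in `Ω` factors through a map `g : Z → Y` without a
section, then `X` embeds into every right `Ω`-approximation of `Z`. -/
lemma IrredIn.length_le_of_factors {A : Type} [Ring A] {Ω : ModuleCat.{0} A → Prop}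
    {X Y : ModuleCat.{0} A} {f : X ⟶ Y} (hf : IrredIn Ω f) (hX : Ω X) {Z : Type}
    [AddCommGroup Z] [Module A Z] (g : Z →ₗ[A] Y) (k : X →ₗ[A] Z) (hk : g ∘ₗ k = f.hom)
    (hg : ¬ ∃ σ : Y →ₗ[A] Z, g ∘ₗ σ = LinearMap.id) {W : ModuleCat.{0} A} (φ : W →ₗ[A] Z)
    (hφ : RightApprox Ω (ModuleCat.ofHom φ)) : Module.length A X ≤ Module.length A W := by
  have hφ' := (rightApprox_ofHom_iff φ).1 hφ
  obtain ⟨h, hh⟩ := hφ'.2 X hX k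
  have hfac : f = ModuleCat.ofHom h ≫ ModuleCat.ofHom (g ∘ₗ φ) :=
    ModuleCat.hom_ext (by rw [← hk, ← hh]; rfl)
  rcases hf.2.2 W hφ'.1 _ _ hfac with hm | he
  · have : Mono (ModuleCat.ofHom h) := inferInstance
    exact Module.length_le_of_injective h ((ModuleCat.mono_iff_injective _).1 this)
  · obtain ⟨⟨σ, hσ⟩⟩ := he
    exact absurd ⟨φ ∘ₗ σ.hom, congrArg ModuleCat.Hom.hom hσ⟩ hg

/-!
Statement 4: if `f : X → Y` is an `Ω`-irreducible morphism between indecomposable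
modules in a functorially finite resolving subcategory `Ω`, then
`|l(X) − l(Y)| ≤ l(Y)·p` with `p = s(1 + m²) − 1`, where `m = max(l(ₐA), l(Aₐ))` and
`s = max { l(X_S) : S simple }`.
-/

theorem stmt_4 {K : Type} [Field K] [IsAlgClosed K]
    {A : Type} [Ring A] [Algebra K A] [FiniteDimensional K A]
    (Ω : ModuleCat.{0} A → Prop)
    (hsub : IsSubcat Ω) (hff : FunctoriallyFinite Ω) (hres : Resolving Ω)
    -- `len` is the Jordan–Hölder length function on left `A`-modules
    (len : ModuleCat.{0} A → ℕ)
    (hlen : ∀ X : ModuleCat.{0} A, Module.Finite A X → IsJHLength X (len X))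
    -- `mr` is the Jordan–Hölder length of `A` as a right `A`-module
    (mr : ℕ)
    (hmr : ∃ t : CompositionSeries (Submodule Aᵐᵒᵖ A), t.head = ⊥ ∧ t.last = ⊤ ∧ t.length = mr)
    -- `m = max(l(ₐA), l(Aₐ))`
    (m : ℕ) (hm : m = max (len (ModuleCat.of A A)) mr)
    -- `s = max { l(X_S) : S simple }`
    (s : ℕ)
    (hs : ∀ (S XS : ModuleCat.{0} A) (fS : XS ⟶ S), IsSimpleModule A S →
      MinimalRightApprox Ω fS → len XS ≤ s)
    (hattained : ∃ (S XS : ModuleCat.{0} A) (fS : XS ⟶ S), IsSimpleModule A S ∧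
      MinimalRightApprox Ω fS ∧ len XS = s)
    -- `p = s(1 + m²) − 1`
    (p : ℕ) (hp : p = s * (1 + m ^ 2) - 1)
    (X Y : ModuleCat.{0} A) (hXΩ : Ω X) (hYΩ : Ω Y)
    (hXind : Indec X) (hYind : Indec Y)
    (f : X ⟶ Y) (hf : IrredIn Ω f) :
    |(len X : ℤ) - (len Y : ℤ)| ≤ (len Y : ℤ) * (p : ℤ) := by
  have : IsArtinianRing A := IsArtinianRing.of_finite K A
  have hlen' : ∀ X : ModuleCat.{0} A, Module.Finite A X → Module.length A X = len X := by
    intro X hX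
    obtain ⟨t, h0, h1, h2⟩ := hlen X hX
    rw [← Module.length_compositionSeries t h0 h1, h2]
  have hXfin : Module.Finite A X := hsub.1 X hXΩ
  have hYfin : Module.Finite A Y := hsub.1 Y hYΩ
  have hs' : ∀ (S X : ModuleCat.{0} A) (φ : X ⟶ S), IsSimpleModule A S →
      MinimalRightApprox Ω φ → Module.length A X ≤ s := fun S X φ hS hφ => by
    rw [hlen' X (hsub.1 X hφ.1.1)]
    exact_mod_cast hs S X φ hS hφ
  have hA : Module.length A A = len (ModuleCat.of A A) :=
    hlen' (ModuleCat.of A A) (inferInstanceAs (Module.Finite A A))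
  have hAr : Module.length Aᵐᵒᵖ A = mr := by
    obtain ⟨t, h0, h1, h2⟩ := hmr
    rw [← Module.length_compositionSeries t h0 h1, h2]
  have hAm : Module.length A A ≤ m := by rw [hA, hm]; exact_mod_cast le_max_left _ _
  have hArm : Module.length Aᵐᵒᵖ A ≤ m := by rw [hAr, hm]; exact_mod_cast le_max_right _ _
  have hY := hlen' Y hYfin
  -- `f` factors through a map without a section whose domain is short
  obtain ⟨Z, _, _, _, g, k, hk, hg, hZ⟩ : ∃ (Z : Type) (_ : AddCommGroup Z) (_ : Module A Z)
      (_ : Module.Finite A Z) (g : Z →ₗ[A] Y) (k : X →ₗ[A] Z), g ∘ₗ k = f.hom ∧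
      (¬ ∃ σ : Y →ₗ[A] Z, g ∘ₗ σ = LinearMap.id) ∧
      Module.length A Z ≤ (len Y * (1 + m ^ 2) : ℕ) := by
    by_cases hsurj : Function.Surjective f.hom
    · have hsec : ¬ ∃ σ : Y →ₗ[A] X, f.hom ∘ₗ σ = LinearMap.id := fun ⟨σ, hσ⟩ =>
        hf.2.1 ⟨⟨ModuleCat.ofHom σ, ModuleCat.hom_ext hσ⟩⟩
      obtain ⟨N, hN, h1, h2⟩ := exists_quotient_no_section (K := K) f.hom hsurj hsec m m (len Y)
        hAm hArm hY.le
      refine ⟨X ⧸ N, _, _, inferInstance, _, N.mkQ, N.liftQ_mkQ f.hom hN, h1, h2.trans ?_⟩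
      rw [hY, ← Nat.cast_add]
      exact_mod_cast (by ring_nf : len Y + len Y * m * m = len Y * (1 + m ^ 2)).le
    · refine ⟨LinearMap.range f.hom, _, _, inferInstance, (LinearMap.range f.hom).subtype,
        f.hom.rangeRestrict, rfl, fun ⟨σ, hσ⟩ => hsurj fun y => ?_, ?_⟩
      · have h := LinearMap.congr_fun hσ y
        obtain ⟨x, hx⟩ := (σ y).2
        exact ⟨x, hx.trans h⟩
      · refine (Module.length_le_of_injective _
          (LinearMap.range f.hom).injective_subtype).trans ?_
        rw [hY]
        exact_mod_cast Nat.le_mul_of_pos_right _ (by positivity)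
  have hZ' : Module.length A Z = len (ModuleCat.of A Z) := hlen' (ModuleCat.of A Z) ‹_›
  obtain ⟨W, φ, hφ, hW⟩ := exists_rightApprox_length_le hsub hff.1 hres s hs' _ Z hZ'
  have hXW := hf.length_le_of_factors hXΩ g k hk hg φ hφ
  have hXle : len X ≤ s * (len Y * (1 + m ^ 2)) := by
    rw [hlen' X hXfin] at hXW
    rw [hZ'] at hZ
    have h1 : len X ≤ s * len (ModuleCat.of A Z) := by exact_mod_cast hXW.trans hW
    exact h1.trans (Nat.mul_le_mul_left s (by exact_mod_cast hZ))
  have hXpos : 0 < len X := by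
    have := hXind.1
    have h := Module.length_pos (R := A) (M := X)
    rw [hlen' X hXfin] at h
    exact_mod_cast h
  have hApos : 0 < m := by
    have := hXind.1
    have : Nontrivial A := Module.nontrivial A X
    have h := (Module.length_pos (R := A) (M := A)).trans_le hAm
    exact_mod_cast h
  have hspos : 0 < s := Nat.pos_of_ne_zero fun h => by simp [h] at hXle; omega
  have hp' : p + 1 = s * (1 + m ^ 2) := by
    rw [hp]
    exact Nat.sub_add_cancel (Nat.mul_pos hspos (by positivity))
  have hp1 : 1 ≤ p := by nlinarith [Nat.mul_le_mul hspos (Nat.pow_le_pow_left hApos 2)]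
  have h1 : len X ≤ len Y * (p + 1) := by rw [hp']; linarith
  zify at h1 hp1
  rw [abs_le]
  constructor <;> nlinarith [Int.natCast_nonneg (len X), Int.natCast_nonneg (len Y)]
end
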